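/- arXiv:2503.15780 — 5 statements merged into one kernel-verified Lean document; each statement's English description precedes it below -/
import Mathlib

section
/- Let Ψ be analytic and injective on 𝔻 with Ψ(𝔻) convex, Ψ(0) = 1, and Re Ψ(z) > 0 for all z ∈ 𝔻. Let c ≥ 0 be an integer and let f be a normalized analytic function on 𝔻 such that f(z) ≠ 0 and z·f'(z)/f(z) ∈ Ψ(𝔻) for all z ∈ 𝔻 \ {0} (i.e., z f'/f is subordinate to Ψ). Then F = B_c(f) satisfies the same condition: F(z) ≠ 0 and z·F'(z)/F(z) ∈ Ψ(𝔻) for all z ∈ 𝔻 \ {0}. Hence the class ℱ = {f normalized analytic : z f'/f ≺ Ψ} is preserved by the Bernardi transform. -/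
open Complex Metric Set

/-- Integral along the segment from `0` to `z`: `∫₀ᶻ g(ζ) dζ = z • ∫₀¹ g(tz) dt`. -/
noncomputable def segIntegral (g : ℂ → ℂ) (z : ℂ) : ℂ :=
  z * ∫ t in (0:ℝ)..1, g ((t : ℂ) * z)

/-- The integrand `ζ^(c-1) f(ζ) = ζ^c · (f(ζ)/ζ)`, with `f(ζ)/ζ` extended by `f'(0)` at `ζ = 0`. -/
noncomputable def bernardiIntegrand (c : ℕ) (f : ℂ → ℂ) (ζ : ℂ) : ℂ :=
  (if ζ = 0 then deriv f 0 else f ζ / ζ) * ζ ^ c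

/-- The Bernardi transform `B_c(f)(z) = ((1+c)/z^c) ∫₀ᶻ ζ^(c-1) f(ζ) dζ`, with value `0` at `0`. -/
noncomputable def bernardi (c : ℕ) (f : ℂ → ℂ) (z : ℂ) : ℂ :=
  if z = 0 then 0 else ((1 + c : ℂ) / z ^ c) * segIntegral (bernardiIntegrand c f) z

/-- First-order conditions at a point where a real-linear functional of a holomorphic function is
maximal over a disk centred at the origin. -/
theorem IsMaxOn.deriv_conditions_closedBall {q : ℂ → ℂ} {q' z₀ : ℂ} {r : ℝ} (ℓ : ℂ →L[ℝ] ℝ)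
    (hq : HasDerivAt q q' z₀) (hz₀ : z₀ ∈ closedBall (0 : ℂ) r)
    (hmax : IsMaxOn (fun z => ℓ (q z)) (closedBall 0 r) z₀) :
    0 ≤ ℓ (z₀ * q') ∧ ℓ (I * (z₀ * q')) = 0 := by
  constructor
  · have hd : HasFDerivAt (fun z => ℓ (q z)) _ z₀ :=
      ℓ.hasFDerivAt.comp z₀ (hq.hasFDerivAt.restrictScalars ℝ)
    have hr : 0 ≤ r := (norm_nonneg z₀).trans (mem_closedBall_zero_iff.mp hz₀)
    have hcone : (0 : ℂ) - z₀ ∈ posTangentConeAt (closedBall (0 : ℂ) r) z₀ :=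
      sub_mem_posTangentConeAt_of_segment_subset
        ((convex_closedBall 0 r).segment_subset hz₀ (mem_closedBall_self hr))
    have := hmax.localize.hasFDerivWithinAt_nonpos hd.hasFDerivWithinAt hcone
    simpa using this
  · have hrot : HasDerivAt (fun t : ℝ => cexp (t * I) * z₀) (I * z₀) 0 := by
      have h1 : HasDerivAt (fun t : ℝ => (t : ℂ) * I) (1 * I) 0 :=
        (Complex.ofRealCLM.hasDerivAt (x := (0 : ℝ))).mul_const I
      simpa using h1.cexp.mul_const z₀
    have hq0 : HasDerivAt q q' (cexp (((0 : ℝ) : ℂ) * I) * z₀) := by simpa using hq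
    have hd : HasDerivAt (fun t : ℝ => ℓ (q (cexp (t * I) * z₀))) (ℓ (q' * (I * z₀))) 0 :=
      ℓ.hasFDerivAt.comp_hasDerivAt (0 : ℝ) (hq0.comp (0 : ℝ) hrot)
    have hloc : IsLocalMax (fun t : ℝ => ℓ (q (cexp (t * I) * z₀))) 0 := by
      refine Filter.Eventually.of_forall fun t => ?_
      have ht : cexp (t * I) * z₀ ∈ closedBall (0 : ℂ) r := by
        simpa [norm_exp_ofReal_mul_I] using hz₀
      simpa using hmax ht
    rw [← hloc.hasDerivAt_eq_zero hd]
    ring_nf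

theorem exists_isMaxOn_closedBall {q : ℂ → ℂ} (hq : DifferentiableOn ℂ q (ball 0 1))
    (ℓ : ℂ →L[ℝ] ℝ) {z : ℂ} (hz : z ∈ ball (0 : ℂ) 1) :
    ∃ z₀ ∈ ball (0 : ℂ) 1, ℓ (q z) ≤ ℓ (q z₀) ∧
      0 ≤ ℓ (z₀ * deriv q z₀) ∧ ℓ (I * (z₀ * deriv q z₀)) = 0 := by
  have hsub : closedBall (0 : ℂ) ‖z‖ ⊆ ball 0 1 :=
    closedBall_subset_ball (mem_ball_zero_iff.mp hz)
  obtain ⟨z₀, hz₀, hmax⟩ := (isCompact_closedBall (0 : ℂ) ‖z‖).exists_isMaxOn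
    (f := fun w => ℓ (q w)) ⟨z, by simp⟩
    (ℓ.continuous.comp_continuousOn (hq.continuousOn.mono hsub))
  refine ⟨z₀, hsub hz₀, hmax (by simp), ?_⟩
  exact hmax.deriv_conditions_closedBall ℓ
    (hq.differentiableAt (isOpen_ball.mem_nhds (hsub hz₀))).hasDerivAt hz₀

theorem re_pos_of_mul_deriv_add_mul_eq_one {h P : ℂ → ℂ}
    (hh : DifferentiableOn ℂ h (ball 0 1)) (hP : ∀ z ∈ ball (0 : ℂ) 1, 0 < (P z).re)
    (hode : ∀ z ∈ ball (0 : ℂ) 1, z * deriv h z + h z * P z = 1)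
    {z : ℂ} (hz : z ∈ ball (0 : ℂ) 1) : 0 < (h z).re := by
  obtain ⟨z₀, hz₀, hle, hre, him⟩ := exists_isMaxOn_closedBall hh (-reCLM) hz
  have hPz := hP z₀ hz₀
  rw [eq_sub_of_add_eq (hode z₀ hz₀)] at hre him
  simp at hle hre him
  refine lt_of_lt_of_le ?_ hle
  by_contra hx
  push Not at hx
  have h1 : (h z₀).re * (P z₀).re ≤ 0 := mul_nonpos_of_nonpos_of_nonneg hx hPz.le
  have h2 : (h z₀).im * (P z₀).im * (P z₀).re = -((h z₀).re * (P z₀).im ^ 2) := by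
    linear_combination (-(P z₀).im) * him
  have h3 : 0 ≤ -((h z₀).re * (P z₀).im ^ 2) := by nlinarith [sq_nonneg (P z₀).im]
  nlinarith

/-- The Briot–Bouquet differential subordination into an open convex set, written in terms of
`h = 1 / (q + c)`, where `q` solves `q + z q' / (q + c) = p`. -/
theorem inv_sub_mem_of_mul_deriv_add_mul_eq_one {h p : ℂ → ℂ} {S : Set ℂ} {c : ℂ}
    (hSo : IsOpen S) (hSc : Convex ℝ S) (hh : DifferentiableOn ℂ h (ball 0 1))
    (hpS : ∀ z ∈ ball (0 : ℂ) 1, p z ∈ S) (hp : ∀ z ∈ ball (0 : ℂ) 1, 0 < (c + p z).re)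
    (hode : ∀ z ∈ ball (0 : ℂ) 1, z * deriv h z + h z * (c + p z) = 1)
    {z : ℂ} (hz : z ∈ ball (0 : ℂ) 1) : (h z)⁻¹ - c ∈ S := by
  have hre : ∀ w ∈ ball (0 : ℂ) 1, 0 < (h w).re := fun w hw =>
    re_pos_of_mul_deriv_add_mul_eq_one hh hp hode hw
  have hne : ∀ w ∈ ball (0 : ℂ) 1, h w ≠ 0 := fun w hw h0 => by simpa [h0] using hre w hw
  by_contra hS
  obtain ⟨ℓ, hℓ⟩ := geometric_hahn_banach_open_point hSc hSo hS
  obtain ⟨z₀, hz₀, hle, hrad, hrot⟩ := exists_isMaxOn_closedBall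
    (q := fun w => (h w)⁻¹ - c) ((hh.inv hne).sub_const c) ℓ hz
  have hd : deriv (fun w => (h w)⁻¹ - c) z₀ = -deriv h z₀ / h z₀ ^ 2 :=
    (((hh.differentiableAt (isOpen_ball.mem_nhds hz₀)).hasDerivAt.inv
      (hne z₀ hz₀)).sub_const c).deriv
  set d := z₀ * deriv (fun w => (h w)⁻¹ - c) z₀ with hd_def
  have hpq : p z₀ = ((h z₀)⁻¹ - c) + ((h z₀).re • d + (h z₀).im • (I * d)) := by
    have hmul : (h z₀).re • d + (h z₀).im • (I * d) = h z₀ * d := by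
      conv_rhs => rw [← re_add_im (h z₀)]
      simp only [real_smul]
      ring
    have hne₀ := hne z₀ hz₀
    rw [hmul, hd_def, hd]
    field_simp
    linear_combination hode z₀ hz₀
  have hlt := hℓ _ (hpS z₀ hz₀)
  rw [hpq, map_add, map_add, map_smul, map_smul, hrot, smul_zero, add_zero, smul_eq_mul] at hlt
  have := mul_nonneg (hre z₀ hz₀).le hrad
  linarith

theorem ofReal_mul_mem_ball_zero {t r : ℝ} (ht₀ : 0 ≤ t) (ht₁ : t ≤ 1) {z : ℂ}
    (hz : z ∈ ball (0 : ℂ) r) : (t : ℂ) * z ∈ ball (0 : ℂ) r := by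
  rw [mem_ball_zero_iff] at hz ⊢
  rw [norm_mul, norm_real, Real.norm_of_nonneg ht₀]
  exact (mul_le_of_le_one_left (norm_nonneg z) ht₁).trans_lt hz

/-- The weighted radial average `z ↦ ∫₀¹ tᶜ g(tz) dt`. -/
noncomputable def radialAverage (c : ℕ) (g : ℂ → ℂ) (z : ℂ) : ℂ :=
  ∫ t in (0 : ℝ)..1, (t : ℂ) ^ c * g (t * z)

theorem continuousOn_pow_mul_radial {g : ℂ → ℂ} (hg : ContinuousOn g (ball 0 1)) (n : ℕ)
    {z : ℂ} (hz : z ∈ ball (0 : ℂ) 1) :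
    ContinuousOn (fun t : ℝ => (t : ℂ) ^ n * g (t * z)) (uIcc 0 1) := by
  rw [uIcc_of_le zero_le_one]
  refine ContinuousOn.mul (by fun_prop) (hg.comp (by fun_prop) fun t ht => ?_)
  exact ofReal_mul_mem_ball_zero ht.1 ht.2 hz

theorem hasDerivAt_radialAverage {g : ℂ → ℂ} (hg : DifferentiableOn ℂ g (ball 0 1)) (c : ℕ)
    {z : ℂ} (hz : z ∈ ball (0 : ℂ) 1) :
    HasDerivAt (radialAverage c g) (radialAverage (c + 1) (deriv g) z) z := by
  have hg' : ContinuousOn (deriv g) (ball 0 1) := (hg.deriv isOpen_ball).continuousOn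
  obtain ⟨r, hzr, hr⟩ := exists_between (mem_ball_zero_iff.mp hz)
  have hsub : closedBall (0 : ℂ) r ⊆ ball 0 1 := closedBall_subset_ball hr
  obtain ⟨M, hM⟩ := (isCompact_closedBall (0 : ℂ) r).exists_bound_of_continuousOn
    (hg'.mono hsub)
  have hmeas : ∀ {k : ℂ → ℂ}, ContinuousOn k (ball 0 1) → ∀ n : ℕ, ∀ w ∈ ball (0 : ℂ) 1,
      MeasureTheory.AEStronglyMeasurable (fun t : ℝ => (t : ℂ) ^ n * k (t * w))
        (MeasureTheory.volume.restrict (uIoc 0 1)) := fun hk n w hw =>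
    ((continuousOn_pow_mul_radial hk n hw).mono uIoc_subset_uIcc).aestronglyMeasurable
      measurableSet_uIoc
  refine (intervalIntegral.hasDerivAt_integral_of_dominated_loc_of_deriv_le
    (F := fun w (t : ℝ) => (t : ℂ) ^ c * g (t * w))
    (F' := fun w (t : ℝ) => (t : ℂ) ^ (c + 1) * deriv g (t * w))
    (s := ball 0 r) (bound := fun _ => M)
    (isOpen_ball.mem_nhds (mem_ball_zero_iff.mpr hzr)) ?_ ?_ ?_ ?_ ?_ ?_).2
  · filter_upwards [isOpen_ball.mem_nhds hz] with w hw
    exact hmeas hg.continuousOn c w hw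
  · exact (continuousOn_pow_mul_radial hg.continuousOn c hz).intervalIntegrable
  · exact hmeas hg' (c + 1) z hz
  · refine Filter.Eventually.of_forall fun t ht w hw => ?_
    rw [uIoc_of_le zero_le_one] at ht
    have hk := hM _ (ball_subset_closedBall (ofReal_mul_mem_ball_zero ht.1.le ht.2 hw))
    rw [norm_mul, norm_pow, norm_real, Real.norm_of_nonneg ht.1.le]
    exact (mul_le_of_le_one_left (norm_nonneg _) (pow_le_one₀ ht.1.le ht.2)).trans hk
  · exact intervalIntegrable_const
  · refine Filter.Eventually.of_forall fun t ht w hw => ?_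
    rw [uIoc_of_le zero_le_one] at ht
    have hmem := hsub (ball_subset_closedBall (ofReal_mul_mem_ball_zero ht.1.le ht.2 hw))
    have h1 : HasDerivAt (fun w : ℂ => (t : ℂ) * w) (t * 1) w := (hasDerivAt_id w).const_mul _
    have h2 := (((hg.differentiableAt (isOpen_ball.mem_nhds hmem)).hasDerivAt.comp w h1).const_mul
      ((t : ℂ) ^ c))
    refine h2.congr_deriv ?_
    ring

theorem radialAverage_ode {g : ℂ → ℂ} (hg : DifferentiableOn ℂ g (ball 0 1)) (c : ℕ)
    {z : ℂ} (hz : z ∈ ball (0 : ℂ) 1) :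
    (c + 1) * radialAverage c g z + z * radialAverage (c + 1) (deriv g) z = g z := by
  have hg' : ContinuousOn (deriv g) (ball 0 1) := (hg.deriv isOpen_ball).continuousOn
  have hi₁ := (continuousOn_pow_mul_radial hg.continuousOn c hz).intervalIntegrable
    (μ := MeasureTheory.volume)
  have hi₂ := (continuousOn_pow_mul_radial hg' (c + 1) hz).intervalIntegrable
    (μ := MeasureTheory.volume)
  have hftc := intervalIntegral.integral_eq_sub_of_hasDerivAt
    (f := fun t : ℝ => (t : ℂ) ^ (c + 1) * g (t * z))
    (f' := fun t : ℝ => (c + 1) * ((t : ℂ) ^ c * g (t * z)) +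
      z * ((t : ℂ) ^ (c + 1) * deriv g (t * z))) (a := 0) (b := 1) ?_
      ((hi₁.const_mul _).add (hi₂.const_mul _))
  · rw [intervalIntegral.integral_add (hi₁.const_mul _) (hi₂.const_mul _),
      intervalIntegral.integral_const_mul, intervalIntegral.integral_const_mul] at hftc
    simpa [radialAverage] using hftc
  · intro t ht
    rw [uIcc_of_le zero_le_one] at ht
    have hmem := ofReal_mul_mem_ball_zero ht.1 ht.2 hz
    have h0 : HasDerivAt (fun t : ℝ => (t : ℂ)) 1 t := Complex.ofRealCLM.hasDerivAt
    have h1 := (hg.differentiableAt (isOpen_ball.mem_nhds hmem)).hasDerivAt.comp t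
      (h0.mul_const z)
    refine ((h0.pow (c + 1)).mul h1).congr_deriv ?_
    simp
    ring

theorem bernardi_eq_mul_radialAverage (c : ℕ) {f : ℂ → ℂ} (hf0 : f 0 = 0) (z : ℂ) :
    bernardi c f z = (c + 1) * (z * radialAverage c (dslope f 0) z) := by
  rcases eq_or_ne z 0 with rfl | hz
  · simp [bernardi]
  have hint : ∀ t : ℝ, bernardiIntegrand c f (t * z) =
      z ^ c * ((t : ℂ) ^ c * dslope f 0 (t * z)) := fun t => by
    have hds : (if (t : ℂ) * z = 0 then deriv f 0 else f (t * z) / (t * z)) =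
        dslope f 0 (t * z) := by
      split_ifs with h
      · rw [h, dslope_same]
      · rw [dslope_of_ne _ h, slope_def_field, hf0, sub_zero, sub_zero]
    rw [bernardiIntegrand, hds]
    ring
  simp only [bernardi, if_neg hz, segIntegral, hint, intervalIntegral.integral_const_mul]
  rw [← radialAverage]
  field_simp
  ring

theorem isOpen_image_ball_of_injOn {Ψ : ℂ → ℂ} (hΨa : AnalyticOnNhd ℂ Ψ (ball 0 1))
    (hΨi : Set.InjOn Ψ (ball 0 1)) : IsOpen (Ψ '' ball 0 1) := by
  rcases hΨa.is_constant_or_isOpen (convex_ball 0 1).isPreconnected with ⟨w, hw⟩ | h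
  · have h0 : (0 : ℂ) ∈ ball (0 : ℂ) 1 := by simp
    have h1 : (1 / 2 : ℂ) ∈ ball (0 : ℂ) 1 := by simp; norm_num
    have := hΨi h0 h1 ((hw _ h0).trans (hw _ h1).symm)
    norm_num at this
  · exact h _ subset_rfl isOpen_ball

/-- If `Ψ` is convex univalent on `𝔻` with `Ψ(0) = 1` and `Re Ψ > 0`, then the
class `ℱ = {f : z f'/f ≺ Ψ}` is preserved by the Bernardi transform `B_c`, `c = 0, 1, 2, ⋯`. -/
theorem bernardi_preserves_MMT (Ψ : ℂ → ℂ) (hΨa : AnalyticOnNhd ℂ Ψ (ball 0 1))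
    (hΨi : Set.InjOn Ψ (ball 0 1)) (hΨc : Convex ℝ (Ψ '' ball 0 1))
    (hΨ0 : Ψ 0 = 1) (hΨre : ∀ z ∈ ball (0 : ℂ) 1, 0 < (Ψ z).re)
    (c : ℕ) (f : ℂ → ℂ) (hf : AnalyticOnNhd ℂ f (ball 0 1)) (hf0 : f 0 = 0)
    (hf1 : deriv f 0 = 1)
    (hsub : ∀ z ∈ ball (0 : ℂ) 1, z ≠ 0 →
      f z ≠ 0 ∧ z * deriv f z / f z ∈ Ψ '' ball 0 1) :
    ∀ z ∈ ball (0 : ℂ) 1, z ≠ 0 →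
      bernardi c f z ≠ 0 ∧
        z * deriv (bernardi c f) z / bernardi c f z ∈ Ψ '' ball 0 1 := by
  have hgd : DifferentiableOn ℂ (dslope f 0) (ball 0 1) :=
    (differentiableOn_dslope (ball_mem_nhds 0 one_pos)).mpr hf.differentiableOn
  set g := dslope f 0 with hg_def
  have hfg : ∀ z, f z = z * g z := fun z => by
    have := sub_smul_dslope f 0 z
    simpa [hf0] using this.symm
  have hg0 : g 0 = 1 := by rw [hg_def, dslope_same, hf1]
  have hgne : ∀ z ∈ ball (0 : ℂ) 1, g z ≠ 0 := fun z hz h => by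
    rcases eq_or_ne z 0 with rfl | hz0
    · simp [hg0] at h
    · exact (hsub z hz hz0).1 (by rw [hfg, h, mul_zero])
  have hgat : ∀ z ∈ ball (0 : ℂ) 1, HasDerivAt g (deriv g z) z := fun z hz =>
    (hgd.differentiableAt (isOpen_ball.mem_nhds hz)).hasDerivAt
  have hKat : ∀ z ∈ ball (0 : ℂ) 1,
      HasDerivAt (radialAverage c g) (radialAverage (c + 1) (deriv g) z) z :=
    fun z hz => hasDerivAt_radialAverage hgd c hz
  set p : ℂ → ℂ := fun z => 1 + z * deriv g z / g z with hp_def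
  set h : ℂ → ℂ := fun z => radialAverage c g z / g z with hh_def
  have hpS : ∀ z ∈ ball (0 : ℂ) 1, p z ∈ Ψ '' ball 0 1 := fun z hz => by
    rcases eq_or_ne z 0 with rfl | hz0
    · exact ⟨0, hz, by simp [hp_def, hΨ0]⟩
    · have hd : HasDerivAt f (1 * g z + z * deriv g z) z := by
        rw [show f = fun z => z * g z from funext hfg]
        exact (hasDerivAt_id z).mul (hgat z hz)
      have hmem := (hsub z hz hz0).2
      have hne := hgne z hz
      rw [hd.deriv, hfg z] at hmem
      convert hmem using 1
      simp only [hp_def]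
      field_simp
  have hpre : ∀ z ∈ ball (0 : ℂ) 1, 0 < ((c : ℂ) + p z).re := fun z hz => by
    obtain ⟨w, hw, hwz⟩ := hpS z hz
    have := hΨre w hw
    rw [hwz] at this
    rw [add_re, natCast_re]
    positivity
  have hhat : ∀ z ∈ ball (0 : ℂ) 1, HasDerivAt h _ z := fun z hz =>
    (hKat z hz).div (hgat z hz) (hgne z hz)
  have hhd : DifferentiableOn ℂ h (ball 0 1) := fun z hz =>
    (hhat z hz).differentiableAt.differentiableWithinAt
  have hode : ∀ z ∈ ball (0 : ℂ) 1, z * deriv h z + h z * (c + p z) = 1 := fun z hz => by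
    have hne := hgne z hz
    have hK := radialAverage_ode hgd c hz
    rw [(hhat z hz).deriv]
    simp only [hh_def, hp_def]
    field_simp
    linear_combination g z * hK
  intro z hz hz0
  have hhre := re_pos_of_mul_deriv_add_mul_eq_one hhd hpre hode hz
  have hKne : radialAverage c g z ≠ 0 := fun h0 => by simp [hh_def, h0] at hhre
  have hc : (c : ℂ) + 1 ≠ 0 := Nat.cast_add_one_ne_zero c
  have hB : bernardi c f = fun z => (c + 1) * (z * radialAverage c g z) :=
    funext (bernardi_eq_mul_radialAverage c hf0)
  have hBd : HasDerivAt (bernardi c f) ((c + 1) * (1 * radialAverage c g z +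
      z * radialAverage (c + 1) (deriv g) z)) z := by
    rw [hB]
    exact ((hasDerivAt_id z).mul (hKat z hz)).const_mul _
  refine ⟨by simp [hB, hc, hz0, hKne], ?_⟩
  convert inv_sub_mem_of_mul_deriv_add_mul_eq_one (isOpen_image_ball_of_injOn hΨa hΨi) hΨc hhd
    hpS hpre hode hz using 1
  rw [hBd.deriv, hB]
  simp only [hh_def, inv_div]
  field_simp
  linear_combination radialAverage_ode hgd c hz
end

section
/- Let g, k be analytic on 𝔻 with g(0) = 0, k(0) = 0, g not identically zero, g(z) ≠ 0 for z ∈ 𝔻 \ {0}, and Re(z·g'(z)/g(z)) > 0 for all z ∈ 𝔻 \ {0}. Let Φ be analytic and injective on 𝔻 with Φ(𝔻) convex. Suppose q is analytic on 𝔻 with q(z)·g'(z) = k'(z) for all z ∈ 𝔻, q(0) = Φ(0), and q(𝔻) ⊆ Φ(𝔻) (i.e., k'/g' ≺ Φ), and suppose h is analytic on 𝔻 with h(z)·g(z) = k(z) for all z ∈ 𝔻 and h(0) = Φ(0). Then h(𝔻) ⊆ Φ(𝔻); that is, k/g ≺ Φ. -/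
open Complex Metric Set

/-- At a point `z₁` where a real-linear functional of `h` is maximal over the disk of radius `‖z₁‖`,
the functional is nonnegative on every multiple `p * (z₁ * h'(z₁))` with `0 ≤ Re p`. -/
theorem nonneg_of_isMaxOn_closedBall {h : ℂ → ℂ} {h' z₁ p : ℂ} (f : ℂ →L[ℝ] ℝ)
    (hh : HasDerivAt h h' z₁)
    (hmax : IsMaxOn (fun z ↦ f (h z)) (closedBall 0 ‖z₁‖) z₁) (hp : 0 ≤ p.re) :
    0 ≤ f (p * (z₁ * h')) := by
  have hcurve : HasDerivAt (fun t : ℝ ↦ z₁ * exp (t * -p)) (z₁ * -p) 0 := by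
    simpa using (((hasDerivAt_id (0 : ℝ)).ofReal_comp.mul_const (-p)).cexp).const_mul z₁
  have hcomp : HasDerivAt (fun t : ℝ ↦ f (h (z₁ * exp (t * -p)))) (f (h' * (z₁ * -p))) 0 := by
    refine f.hasFDerivAt.comp_hasDerivAt (0 : ℝ) (HasDerivAt.comp (0 : ℝ) ?_ hcurve)
    simpa using hh
  have hslope := (hasDerivWithinAt_iff_tendsto_slope' self_notMem_Ioi).1
    (hcomp.hasDerivWithinAt (s := Ioi 0))
  have hle : f (h' * (z₁ * -p)) ≤ 0 := by
    refine le_of_tendsto hslope ?_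
    filter_upwards [self_mem_nhdsWithin] with t ht
    have ht : 0 < t := ht
    have hmem : z₁ * exp (t * -p) ∈ closedBall (0 : ℂ) ‖z₁‖ := by
      rw [mem_closedBall_zero_iff, norm_mul, Complex.norm_exp]
      refine mul_le_of_le_one_right (norm_nonneg _) (Real.exp_le_one_iff.2 ?_)
      simpa using mul_nonneg ht.le hp
    have hle := hmax hmem
    rw [slope_def_field]
    refine div_nonpos_of_nonpos_of_nonneg ?_ (by linarith)
    simpa using hle
  rw [show h' * (z₁ * -p) = -(p * (z₁ * h')) by ring, map_neg] at hle
  linarith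

/-- Lemma 2.1. If `g` maps `𝔻` onto a finitely-sheeted starlike region
(`g(0) = 0`, `g ≠ 0` off the origin, `Re(z g'/g) > 0`), `Φ` is convex univalent, `k(0) = 0`,
`k'/g' ≺ Φ` and `k/g` takes the value `Φ(0)` at `0`, then `k/g ≺ Φ`. -/
theorem subordination_lemma (g k Φ q h : ℂ → ℂ)
    (hg : AnalyticOnNhd ℂ g (ball 0 1)) (hk : AnalyticOnNhd ℂ k (ball 0 1))
    (hg0 : g 0 = 0) (hk0 : k 0 = 0)
    (hgne : ∃ z ∈ ball (0 : ℂ) 1, g z ≠ 0)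
    (hgnz : ∀ z ∈ ball (0 : ℂ) 1, z ≠ 0 → g z ≠ 0)
    (hgstar : ∀ z ∈ ball (0 : ℂ) 1, z ≠ 0 → 0 < (z * deriv g z / g z).re)
    (hΦa : AnalyticOnNhd ℂ Φ (ball 0 1)) (hΦi : Set.InjOn Φ (ball 0 1))
    (hΦc : Convex ℝ (Φ '' ball 0 1))
    (hq : AnalyticOnNhd ℂ q (ball 0 1))
    (hqg : ∀ z ∈ ball (0 : ℂ) 1, q z * deriv g z = deriv k z)
    (hq0 : q 0 = Φ 0) (hqsub : q '' ball 0 1 ⊆ Φ '' ball 0 1)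
    (hh : AnalyticOnNhd ℂ h (ball 0 1))
    (hhg : ∀ z ∈ ball (0 : ℂ) 1, h z * g z = k z) (hh0 : h 0 = Φ 0) :
    h '' ball 0 1 ⊆ Φ '' ball 0 1 := by
  have h0 : (0 : ℂ) ∈ ball (0 : ℂ) 1 := mem_ball_self one_pos
  have hopen : IsOpen (Φ '' ball 0 1) := by
    rcases hΦa.is_constant_or_isOpen (convex_ball _ _).isPreconnected with ⟨w, hw⟩ | hop
    · have h1 : (1 / 2 : ℂ) ∈ ball (0 : ℂ) 1 := by
        rw [mem_ball_zero_iff]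
        norm_num
      have := hΦi h0 h1 ((hw 0 h0).trans (hw _ h1).symm)
      norm_num at this
    · exact hop _ subset_rfl isOpen_ball
  rintro _ ⟨z₀, hz₀, rfl⟩
  by_contra hnot
  obtain ⟨f, hf⟩ := geometric_hahn_banach_open_point hΦc hopen hnot
  have hsub : closedBall (0 : ℂ) ‖z₀‖ ⊆ ball 0 1 :=
    closedBall_subset_ball (mem_ball_zero_iff.1 hz₀)
  obtain ⟨z₁, hz₁, hmax⟩ := (isCompact_closedBall (0 : ℂ) ‖z₀‖).exists_isMaxOn
    ⟨0, mem_closedBall_self (norm_nonneg _)⟩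
    (f.continuous.comp_continuousOn (hh.continuousOn.mono hsub))
  have hz₁b := hsub hz₁
  have hle : f (h z₀) ≤ f (h z₁) := hmax (by simp)
  have hz₁0 : z₁ ≠ 0 := by
    rintro rfl
    rw [hh0] at hle
    exact (hf _ (mem_image_of_mem Φ h0)).not_ge hle
  have hre := hgstar z₁ hz₁b hz₁0
  have hg' : deriv g z₁ ≠ 0 := fun h0 ↦ by simp [h0] at hre
  have hderiv : deriv k z₁ = deriv h z₁ * g z₁ + h z₁ * deriv g z₁ := by
    have heq : k =ᶠ[nhds z₁] h * g := by
      filter_upwards [isOpen_ball.mem_nhds hz₁b] with z hz using (hhg z hz).symm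
    rw [heq.deriv_eq]
    exact deriv_mul (hh z₁ hz₁b).differentiableAt (hg z₁ hz₁b).differentiableAt
  have hqeq : q z₁ = h z₁ + (z₁ * deriv g z₁ / g z₁)⁻¹ * (z₁ * deriv h z₁) := by
    have := hqg z₁ hz₁b
    have := hgnz z₁ hz₁b hz₁0
    field_simp
    linear_combination hqg z₁ hz₁b + hderiv
  have hp : 0 ≤ ((z₁ * deriv g z₁ / g z₁)⁻¹).re := by
    rw [Complex.inv_re]
    exact div_nonneg hre.le (Complex.normSq_nonneg _)
  have hnonneg := nonneg_of_isMaxOn_closedBall f (hh z₁ hz₁b).differentiableAt.hasDerivAt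
    (hmax.on_subset (closedBall_subset_closedBall (mem_closedBall_zero_iff.1 hz₁))) hp
  have hlt := hf _ (hqsub (mem_image_of_mem q hz₁b))
  rw [hqeq, map_add] at hlt
  linarith
end

section
/- Let c ≥ 0 be an integer and let f be a normalized analytic function on 𝔻 that is starlike, i.e., f(z) ≠ 0 and Re(z·f'(z)/f(z)) > 0 for all z ∈ 𝔻 \ {0}. Define k(z) = ∫₀^z ζ^{c−1} f(ζ) dζ (integral along the segment from 0 to z; for c = 0 the integrand f(ζ)/ζ is extended analytically by the value f'(0) at 0). Then k is starlike in the multivalent sense: k(z) ≠ 0 and Re(z·k'(z)/k(z)) > 0 for all z ∈ 𝔻 \ {0}; moreover k is (1+c)-valent, in the sense that for every 0 < r < 1, (1/2π)·∫₀^{2π} Re( r e^{iθ} k'(r e^{iθ}) / k(r e^{iθ}) ) dθ = 1 + c. -/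
open Complex Metric Set

/-- On a disk, the segment integral of a holomorphic function is a primitive of it. -/
lemma hasDerivAt_segIntegral {g : ℂ → ℂ} {R : ℝ} (hg : DifferentiableOn ℂ g (ball 0 R)) {z : ℂ}
    (hz : z ∈ ball (0 : ℂ) R) : HasDerivAt (segIntegral g) (g z) z := by
  obtain ⟨K, hK⟩ := hg.isExactOn_ball
  have key : ∀ w ∈ ball (0 : ℂ) R, segIntegral g w = K w - K 0 := by
    intro w hw
    have hmem : ∀ t ∈ uIcc (0 : ℝ) 1, (t : ℂ) * w ∈ ball (0 : ℂ) R := by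
      intro t ht
      rw [uIcc_of_le zero_le_one] at ht
      have : ‖(t : ℂ) * w‖ ≤ ‖w‖ := by
        rw [norm_mul, norm_real, Real.norm_of_nonneg ht.1]
        exact mul_le_of_le_one_left (norm_nonneg _) ht.2
      rw [mem_ball_zero_iff] at hw ⊢
      exact this.trans_lt hw
    have hder : ∀ t ∈ uIcc (0 : ℝ) 1,
        HasDerivAt (fun t : ℝ => K ((t : ℂ) * w)) (g ((t : ℂ) * w) * w) t := by
      intro t ht
      have h1 : HasDerivAt (fun s : ℂ => s * w) w (t : ℂ) := by
        simpa using (hasDerivAt_id (t : ℂ)).mul_const w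
      exact ((hK _ (hmem t ht)).comp (t : ℂ) h1).comp_ofReal
    have hcont : ContinuousOn (fun t : ℝ => g ((t : ℂ) * w) * w) (uIcc 0 1) :=
      (hg.continuousOn.comp (by fun_prop) hmem).mul continuousOn_const
    have := intervalIntegral.integral_eq_sub_of_hasDerivAt hder hcont.intervalIntegrable
    rw [intervalIntegral.integral_mul_const] at this
    simpa [segIntegral, mul_comm] using this
  refine ((hK z hz).sub_const (K 0)).congr_of_eventuallyEq ?_
  filter_upwards [isOpen_ball.mem_nhds hz] with w hw using key w hw

lemma segIntegral_mul_pow (g : ℂ → ℂ) (c : ℕ) (z : ℂ) :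
    segIntegral (fun ζ => g ζ * ζ ^ c) z =
      z ^ (c + 1) * ∫ t in (0 : ℝ)..1, (t : ℂ) ^ c * g ((t : ℂ) * z) := by
  rw [segIntegral, pow_succ', mul_assoc, ← intervalIntegral.integral_const_mul (z ^ c)]
  congr 2
  ext t
  ring

lemma integral_pow_mul_const (c : ℕ) (a : ℂ) :
    ∫ t in (0 : ℝ)..1, (t : ℂ) ^ c * a = a / (c + 1) := by
  rw [intervalIntegral.integral_mul_const]
  simp_rw [← ofReal_pow]
  rw [intervalIntegral.integral_ofReal, integral_pow]
  simp
  ring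

lemma differentiableOn_integral_pow_mul {g : ℂ → ℂ} {R : ℝ}
    (hg : DifferentiableOn ℂ g (ball 0 R)) (c : ℕ) :
    DifferentiableOn ℂ (fun z => ∫ t in (0 : ℝ)..1, (t : ℂ) ^ c * g ((t : ℂ) * z))
      (ball 0 R) := by
  rcases le_or_gt R 0 with hR | hR
  · rw [ball_eq_empty.2 hR]
    exact differentiableOn_empty
  refine (differentiableOn_compl_singleton_and_continuousAt_iff (ball_mem_nhds 0 hR)).mp ⟨?_, ?_⟩
  · have hG : DifferentiableOn ℂ (fun ζ => g ζ * ζ ^ c) (ball 0 R) := by fun_prop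
    have hS : DifferentiableOn ℂ
        (fun z => segIntegral (fun ζ => g ζ * ζ ^ c) z / z ^ (c + 1)) (ball 0 R \ {0}) := by
      intro z hz
      exact ((hasDerivAt_segIntegral hG hz.1).differentiableAt.div
        (differentiableAt_id.pow (c + 1)) (pow_ne_zero (c + 1) hz.2)).differentiableWithinAt
    refine hS.congr fun z hz => ?_
    rw [segIntegral_mul_pow, mul_div_cancel_left₀ _ (pow_ne_zero _ hz.2)]
  · have hg0 : ContinuousAt g 0 := (hg.differentiableAt (ball_mem_nhds 0 hR)).continuousAt
    rw [Metric.continuousAt_iff] at hg0 ⊢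
    intro ε hε
    obtain ⟨δ, hδ, hgδ⟩ := hg0 (ε / 2) (half_pos hε)
    refine ⟨min δ R, lt_min hδ hR, fun {z} hz => ?_⟩
    rw [dist_zero_right, lt_min_iff] at hz
    have hle : ∀ t ∈ Icc (0 : ℝ) 1, ‖(t : ℂ) * z‖ ≤ ‖z‖ := by
      intro t ht
      rw [norm_mul, norm_real, Real.norm_of_nonneg ht.1]
      exact mul_le_of_le_one_left (norm_nonneg _) ht.2
    have hint : IntervalIntegrable (fun t : ℝ => (t : ℂ) ^ c * g ((t : ℂ) * z))
        MeasureTheory.volume 0 1 := by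
      apply ContinuousOn.intervalIntegrable
      rw [uIcc_of_le zero_le_one]
      refine ContinuousOn.mul (by fun_prop) (hg.continuousOn.comp (by fun_prop) fun t ht => ?_)
      rw [mem_ball_zero_iff]
      exact (hle t ht).trans_lt hz.2
    have hint0 : IntervalIntegrable (fun t : ℝ => (t : ℂ) ^ c * g ((t : ℂ) * 0))
        MeasureTheory.volume 0 1 := by
      apply Continuous.intervalIntegrable
      simp only [mul_zero]
      fun_prop
    rw [dist_eq_norm, ← intervalIntegral.integral_sub hint hint0]
    refine (intervalIntegral.norm_integral_le_of_norm_le_const (C := ε / 2) fun t ht => ?_).trans_lt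
      (by simpa using half_lt_self hε)
    rw [uIoc_of_le zero_le_one] at ht
    have ht' : t ∈ Icc (0 : ℝ) 1 := ⟨ht.1.le, ht.2⟩
    have h1 := hgδ (x := (t : ℂ) * z) (by
      rw [dist_zero_right]; exact (hle t ht').trans_lt hz.1)
    rw [mul_zero, ← mul_sub, norm_mul, norm_pow, norm_real, Real.norm_of_nonneg ht.1.le,
      ← dist_eq_norm]
    exact (mul_le_of_le_one_left dist_nonneg (pow_le_one₀ ht.1.le ht.2)).trans h1.le

/-- At a zero `z` of `Re q`, with `Re q` nonnegative on the disk of radius `‖z‖`, `z * deriv q z` is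
real and nonpositive. -/
lemma mul_deriv_real_nonpos_of_re_eq_zero {q : ℂ → ℂ} {z : ℂ} (hq : DifferentiableAt ℂ q z)
    (hz0 : (q z).re = 0) (hnonneg : ∀ w, ‖w‖ ≤ ‖z‖ → 0 ≤ (q w).re) :
    (z * deriv q z).im = 0 ∧ (z * deriv q z).re ≤ 0 := by
  have hcirc : HasDerivAt (fun θ : ℝ => (q (z * exp (θ * I))).re) (-(z * deriv q z).im) 0 := by
    have h1 : HasDerivAt (fun w : ℂ => z * exp (w * I)) (z * I) ((0 : ℝ) : ℂ) := by
      simpa using (((hasDerivAt_id ((0 : ℝ) : ℂ)).mul_const I).cexp).const_mul z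
    have h2 : HasDerivAt q (deriv q z) (z * exp (((0 : ℝ) : ℂ) * I)) := by
      simpa using hq.hasDerivAt
    have := (h2.comp ((0 : ℝ) : ℂ) h1).real_of_complex
    rwa [mul_left_comm, ← mul_assoc, mul_I_re] at this
  have hrad : HasDerivAt (fun t : ℝ => (q (t * z)).re) (z * deriv q z).re 1 := by
    have h1 : HasDerivAt (fun w : ℂ => w * z) z ((1 : ℝ) : ℂ) := by
      simpa using (hasDerivAt_id ((1 : ℝ) : ℂ)).mul_const z
    have h2 : HasDerivAt q (deriv q z) (((1 : ℝ) : ℂ) * z) := by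
      simpa using hq.hasDerivAt
    have := (h2.comp ((1 : ℝ) : ℂ) h1).real_of_complex
    rwa [mul_comm] at this
  constructor
  · have hmin : IsLocalMin (fun θ : ℝ => (q (z * exp (θ * I))).re) 0 := by
      refine Filter.Eventually.of_forall fun θ => ?_
      have := hnonneg (z * exp (θ * I)) (by simp [norm_exp_ofReal_mul_I])
      simpa [hz0] using this
    exact neg_eq_zero.1 (hmin.hasDerivAt_eq_zero hcirc)
  · refine le_of_tendsto (hasDerivAt_iff_tendsto_slope_left_right.1 hrad).1 ?_
    filter_upwards [Ioo_mem_nhdsLT (zero_lt_one' ℝ)] with t ht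
    have hq0 := hnonneg ((t : ℂ) * z) (by
      rw [norm_mul, norm_real, Real.norm_of_nonneg ht.1.le]
      exact mul_le_of_le_one_left (norm_nonneg _) ht.2.le)
    rw [slope_def_field]
    refine div_nonpos_of_nonneg_of_nonpos ?_ (by linarith [ht.2])
    simpa [hz0] using hq0

/-- **Miller–Mocanu principle** for the right half-plane. -/
lemma re_pos_of_forall_mul_deriv {q : ℂ → ℂ} {R : ℝ} (hq : DifferentiableOn ℂ q (ball 0 R))
    (hq0 : 0 < (q 0).re)
    (h : ∀ z ∈ ball (0 : ℂ) R, z ≠ 0 → (q z).re = 0 → (z * deriv q z).im = 0 →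
      0 < (z * deriv q z).re) {z : ℂ} (hz : z ∈ ball (0 : ℂ) R) : 0 < (q z).re := by
  by_contra! hneg
  rw [mem_ball_zero_iff] at hz
  have hsub : closedBall (0 : ℂ) ‖z‖ ⊆ ball 0 R := closedBall_subset_ball hz
  have hcont : ContinuousOn (fun w => (q w).re) (closedBall 0 ‖z‖) :=
    continuous_re.comp_continuousOn (hq.continuousOn.mono hsub)
  have hcomp : IsCompact (closedBall (0 : ℂ) ‖z‖ ∩ (fun w => (q w).re) ⁻¹' Iic 0) :=
    (isCompact_closedBall _ _).of_isClosed_subset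
      (hcont.preimage_isClosed_of_isClosed isClosed_closedBall isClosed_Iic) inter_subset_left
  obtain ⟨w, ⟨hwz, hw0⟩, hwmin⟩ :=
    hcomp.exists_isMinOn ⟨z, by simp, hneg⟩ continuous_norm.continuousOn
  have hw0 : (q w).re ≤ 0 := hw0
  have hwne : w ≠ 0 := by
    rintro rfl
    exact hw0.not_gt hq0
  have hwz' : ‖w‖ ≤ ‖z‖ := by simpa using hwz
  have hpos : ∀ v ∈ ball (0 : ℂ) ‖w‖, 0 < (q v).re := by
    intro v hv
    rw [mem_ball_zero_iff] at hv
    by_contra! hv0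
    have : ‖w‖ ≤ ‖v‖ := hwmin ⟨by simpa using hv.le.trans hwz', hv0⟩
    exact this.not_gt hv
  have hnonneg : ∀ v, ‖v‖ ≤ ‖w‖ → 0 ≤ (q v).re := by
    intro v hv
    have hcl : v ∈ closure (ball (0 : ℂ) ‖w‖) := by
      rw [closure_ball _ (norm_ne_zero_iff.2 hwne)]
      simpa using hv
    have hc : ContinuousOn (fun w => (q w).re) (closure (ball (0 : ℂ) ‖w‖)) := by
      rw [closure_ball _ (norm_ne_zero_iff.2 hwne)]
      exact hcont.mono (closedBall_subset_closedBall hwz')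
    exact le_on_closure (f := fun _ => (0 : ℝ)) (fun v hv => (hpos v hv).le)
      continuousOn_const hc hcl
  have hre : (q w).re = 0 := le_antisymm hw0 (hnonneg w le_rfl)
  have hwR : w ∈ ball (0 : ℂ) R := hsub hwz
  obtain ⟨him, hle⟩ := mul_deriv_real_nonpos_of_re_eq_zero
    (hq.differentiableAt (isOpen_ball.mem_nhds hwR)) hre hnonneg
  exact hle.not_gt (h w hwR hwne hre him)

/-- If `k` has derivative `z ^ (c - 1) * f z`, then `q = k / (z * k')` satisfies
`z * q' + q * (c + z * f' / f) = 1`. -/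
lemma mul_deriv_div_pow_mul {k f : ℂ → ℂ} {c : ℕ} {z : ℂ} (hz : z ≠ 0) (hfz : f z ≠ 0)
    (hf : DifferentiableAt ℂ f z) (hk : HasDerivAt k (f z / z * z ^ c) z) :
    z * deriv (fun w => k w / (w ^ c * f w)) z
      = 1 - k z / (z ^ c * f z) * (c + z * deriv f z / f z) := by
  have hd := hk.div ((hasDerivAt_pow c z).mul hf.hasDerivAt) (mul_ne_zero (pow_ne_zero c hz) hfz)
  rw [show (fun w => k w / (w ^ c * f w)) = k / ((fun w => w ^ c) * f) from rfl, hd.deriv]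
  have hpow : (c : ℂ) * z ^ (c - 1) = c * z ^ c / z := by
    rcases c with _ | c
    · simp
    · field_simp
      simp [pow_succ]
  simp only [Pi.mul_apply, hpow]
  have := pow_ne_zero c hz
  field_simp

/-- Lemma 2.2. If `f ∈ S*`, then `k(z) = ∫₀ᶻ ζ^(c-1) f(ζ) dζ` is starlike
(in the multivalent sense) and `(1+c)`-valent. -/
theorem integral_starlike_and_valent (c : ℕ) (f : ℂ → ℂ)
    (hf : AnalyticOnNhd ℂ f (ball 0 1)) (hf0 : f 0 = 0) (hf1 : deriv f 0 = 1)
    (hstar : ∀ z ∈ ball (0 : ℂ) 1, z ≠ 0 → f z ≠ 0 ∧ 0 < (z * deriv f z / f z).re) :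
    (∀ z ∈ ball (0 : ℂ) 1, z ≠ 0 →
      segIntegral (bernardiIntegrand c f) z ≠ 0 ∧
        0 < (z * deriv (segIntegral (bernardiIntegrand c f)) z /
          segIntegral (bernardiIntegrand c f) z).re) ∧
    ∀ r : ℝ, 0 < r → r < 1 →
      (1 / (2 * Real.pi)) * ∫ θ in (0:ℝ)..(2 * Real.pi),
        (((r : ℂ) * Complex.exp (θ * Complex.I) *
            deriv (segIntegral (bernardiIntegrand c f)) ((r : ℂ) * Complex.exp (θ * Complex.I)) /
          segIntegral (bernardiIntegrand c f) ((r : ℂ) * Complex.exp (θ * Complex.I)))).re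
        = 1 + c := by
  have hf' : DifferentiableOn ℂ f (ball 0 1) := hf.differentiableOn
  have h0 : (0 : ℂ) ∈ ball (0 : ℂ) 1 := mem_ball_self one_pos
  have hnhds : ∀ {z : ℂ}, z ∈ ball (0 : ℂ) 1 → ball (0 : ℂ) 1 ∈ nhds z :=
    fun hz => isOpen_ball.mem_nhds hz
  set g : ℂ → ℂ := dslope f 0 with hg_def
  have hg : DifferentiableOn ℂ g (ball 0 1) := (differentiableOn_dslope (hnhds h0)).2 hf'
  have hg0 : g 0 = 1 := by rw [hg_def, dslope_same, hf1]
  have hgz : ∀ z, z ≠ 0 → g z = f z / z := by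
    intro z hz
    rw [hg_def, dslope_of_ne _ hz, slope_def_field, hf0, sub_zero, sub_zero]
  have hgne : ∀ z ∈ ball (0 : ℂ) 1, g z ≠ 0 := by
    intro z hz
    by_cases h : z = 0
    · simp [h, hg0]
    · rw [hgz z h]
      exact div_ne_zero (hstar z hz h).1 h
  have hG : bernardiIntegrand c f = fun ζ => g ζ * ζ ^ c := by
    funext ζ
    by_cases h : ζ = 0
    · simp [bernardiIntegrand, h, hg0, hf1]
    · simp [bernardiIntegrand, h, hgz ζ h]
  rw [hG]
  set k : ℂ → ℂ := segIntegral fun ζ => g ζ * ζ ^ c with hk_def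
  have hk : ∀ z ∈ ball (0 : ℂ) 1, HasDerivAt k (g z * z ^ c) z := fun z hz =>
    hasDerivAt_segIntegral (g := fun ζ => g ζ * ζ ^ c) (by fun_prop) hz
  set q : ℂ → ℂ := fun z => (∫ t in (0 : ℝ)..1, (t : ℂ) ^ c * g ((t : ℂ) * z)) / g z with hq_def
  have hq : DifferentiableOn ℂ q (ball 0 1) :=
    (differentiableOn_integral_pow_mul hg c).div hg hgne
  have hq0 : q 0 = ((1 / (c + 1) : ℝ) : ℂ) := by
    simp only [hq_def, mul_zero, integral_pow_mul_const, hg0]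
    simp
  have hqk : ∀ z ∈ ball (0 : ℂ) 1, z ≠ 0 → q z = k z / (z ^ c * f z) := by
    intro z hz h
    have h1 := (hstar z hz h).1
    have h2 := pow_ne_zero c h
    simp only [hq_def, hk_def, segIntegral_mul_pow, hgz z h]
    generalize (∫ t in (0 : ℝ)..1, (t : ℂ) ^ c * g ((t : ℂ) * z)) = J
    rw [pow_succ]
    field_simp
  have hqpos : ∀ z ∈ ball (0 : ℂ) 1, 0 < (q z).re := by
    refine fun z hz => re_pos_of_forall_mul_deriv hq ?_ ?_ hz
    · rw [hq0, ofReal_re]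
      positivity
    · intro z hz h hre him
      have hev : q =ᶠ[nhds z] fun w => k w / (w ^ c * f w) := by
        filter_upwards [hnhds hz, isOpen_ne.mem_nhds h] with w hw hw' using hqk w hw hw'
      have hode := mul_deriv_div_pow_mul h (hstar z hz h).1 (hf'.differentiableAt (hnhds hz))
        (hgz z h ▸ hk z hz)
      rw [← hev.deriv_eq, ← hqk z hz h] at hode
      have hP : 0 < ((c : ℂ) + z * deriv f z / f z).re := by
        rw [add_re, natCast_re]
        exact add_pos_of_nonneg_of_pos c.cast_nonneg (hstar z hz h).2
      rw [hode] at him ⊢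
      simp only [sub_im, one_im, mul_im, hre, zero_mul, zero_add, zero_sub, neg_eq_zero,
        mul_eq_zero, hP.ne', or_false] at him
      simp [hre, him]
  have hqne : ∀ z ∈ ball (0 : ℂ) 1, q z ≠ 0 := fun z hz h => by simpa [h] using hqpos z hz
  have hratio : ∀ z ∈ ball (0 : ℂ) 1, z ≠ 0 → z * deriv k z / k z = (q z)⁻¹ := by
    intro z hz h
    rw [(hk z hz).deriv, hqk z hz h, hgz z h, inv_div]
    field_simp
  refine ⟨fun z hz h => ⟨fun hkz => hqne z hz (by rw [hqk z hz h, hkz, zero_div]), ?_⟩, ?_⟩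
  · rw [hratio z hz h, inv_re]
    exact div_pos (hqpos z hz) (normSq_pos.2 (hqne z hz))
  · intro r hr hr1
    have hharm : InnerProductSpace.HarmonicOnNhd (fun z => ((q z)⁻¹).re)
        (closedBall (0 : ℂ) |r|) := by
      intro z hz
      have hz1 : z ∈ ball (0 : ℂ) 1 :=
        closedBall_subset_ball (by rwa [abs_of_pos hr]) hz
      exact ((hq.inv hqne).analyticAt (hnhds hz1)).harmonicAt_re
    have havg := hharm.circleAverage_eq
    rw [Real.circleAverage_def, hq0, ← ofReal_inv, ofReal_re, smul_eq_mul] at havg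
    rw [one_div, add_comm (1 : ℝ), ← one_div_one_div ((c : ℝ) + 1), one_div (1 / _), ← havg]
    congr 2
    funext θ
    have hmem : (r : ℂ) * exp (θ * I) ∈ ball (0 : ℂ) 1 := by
      rw [mem_ball_zero_iff, norm_mul, norm_exp_ofReal_mul_I, mul_one, norm_real,
        Real.norm_of_nonneg hr.le]
      exact hr1
    rw [hratio _ hmem (mul_ne_zero (ofReal_ne_zero.2 hr.ne') (exp_ne_zero _)), circleMap, zero_add]
end

section
/- Let p ≥ 1 and α ≥ 1 be integers and c ≥ 0 an integer. Let Ψ be analytic and injective on 𝔻 with Ψ(𝔻) convex, Ψ(0) = p, and Re Ψ(z) > −c/α for all z ∈ 𝔻. Let f be analytic on 𝔻, vanishing to order exactly p at 0 (f(z) = a_p z^p + a_{p+1} z^{p+1} + ⋯ with a_p ≠ 0), with f(z) ≠ 0 and z·f'(z)/f(z) ∈ Ψ(𝔻) for all z ∈ 𝔻 \ {0}. Define G(z) = ((c + pα)/z^c)·∫₀^z ζ^{c−1} f(ζ)^α dζ for z ∈ 𝔻 \ {0} (with the analytic extension at 0). Then for all z ∈ 𝔻 \ {0}: G(z) ≠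 0 and (1/α)·(z·G'(z)/G(z)) ∈ Ψ(𝔻). Equivalently, any analytic function F on 𝔻 with F^α = G (an α-th root T(f; p, α, c) of G) satisfies z F'(z)/F(z) ≺ Ψ, so that the class ℱ = {f ∈ 𝔄(p) : z f'/f ≺ Ψ} satisfies T(ℱ; p, α, c) ⊆ ℱ. -/
open Complex Metric Set

/-- `G(z) = ((c + pα)/z^c) ∫₀ᶻ ζ^(c-1) f(ζ)^α dζ`, with value `0` at `0`; the integral is taken
along the segment from `0` to `z` (the integrand `ζ^(c-1) f(ζ)^α = ζ^c f(ζ)^α / ζ` is written so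
that its value at the single point `ζ = 0` is irrelevant to the integral). -/
noncomputable def ksG (p α c : ℕ) (f : ℂ → ℂ) (z : ℂ) : ℂ :=
  if z = 0 then 0 else
    (((c : ℂ) + (p : ℂ) * α) / z ^ c) *
      (z * ∫ t in (0:ℝ)..1, ((t : ℂ) * z) ^ c * (f ((t : ℂ) * z)) ^ α / ((t : ℂ) * z))

open Topology

/-- A holomorphic function on the disk whose real part first reaches the level `b` at `z` has
`z * u'(z)` real and nonnegative there. -/
lemma exists_first_touch {u : ℂ → ℂ} (hu : DifferentiableOn ℂ u (ball 0 1)) {b : ℝ}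
    (h0 : (u 0).re < b) {w : ℂ} (hw : w ∈ ball (0 : ℂ) 1) (hb : b ≤ (u w).re) :
    ∃ z ∈ ball (0 : ℂ) 1, z ≠ 0 ∧ (u z).re = b ∧ ∃ m : ℝ, 0 ≤ m ∧ z * deriv u z = m := by
  have hw1 : ‖w‖ < 1 := by simpa using hw
  have hsub : closedBall (0 : ℂ) ‖w‖ ⊆ ball 0 1 := closedBall_subset_ball hw1
  have hre : ContinuousOn (fun z => (u z).re) (ball 0 1) :=
    continuous_re.comp_continuousOn hu.continuousOn
  have hcomp : IsCompact (closedBall (0 : ℂ) ‖w‖ ∩ (fun z => (u z).re) ⁻¹' Ici b) :=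
    (isCompact_closedBall 0 ‖w‖).of_isClosed_subset
      ((hre.mono hsub).preimage_isClosed_of_isClosed isClosed_closedBall isClosed_Ici)
      inter_subset_left
  obtain ⟨z, ⟨hzw, hzb⟩, hmin⟩ := hcomp.exists_isMinOn ⟨w, by simp, hb⟩ continuous_norm.continuousOn
  have hz : z ∈ ball (0 : ℂ) 1 := hsub hzw
  have hz0 : z ≠ 0 := by
    rintro rfl
    exact absurd h0 (not_lt.mpr hzb)
  have hzball : closedBall (0 : ℂ) ‖z‖ ⊆ ball 0 1 := closedBall_subset_ball (by simpa using hz)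
  have hmax : ∀ x ∈ closedBall (0 : ℂ) ‖z‖, (u x).re ≤ b := by
    rw [← closure_ball (0 : ℂ) (norm_ne_zero_iff.mpr hz0)] at hzball ⊢
    intro x hx
    refine le_on_closure (f := fun x => (u x).re) (g := fun _ => b) (fun y hy => ?_)
      (hre.mono hzball) continuousOn_const hx
    by_contra! hlt
    have hyz : ‖y‖ < ‖z‖ := by simpa using hy
    have hyw : ‖y‖ ≤ ‖w‖ := hyz.le.trans (by simpa using hzw)
    exact absurd (hmin ⟨by simpa using hyw, hlt.le⟩) (not_le.mpr hyz)
  have hzeq : (u z).re = b := le_antisymm (hmax z (by simp)) hzb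
  have hd : HasDerivAt u (deriv u z) z := (hu.differentiableAt (isOpen_ball.mem_nhds hz)).hasDerivAt
  refine ⟨z, hz, hz0, hzeq, (z * deriv u z).re, ?_, ?_⟩
  · have hf : HasFDerivAt (fun x => (u x).re)
        (reCLM.comp (deriv u z • (1 : ℂ →L[ℝ] ℂ))) z :=
      reCLM.hasFDerivAt.comp z hd.complexToReal_fderiv
    have hloc : IsLocalMaxOn (fun x => (u x).re) (closedBall 0 ‖z‖) z := by
      refine IsMaxOn.localize fun x hx => ?_
      simpa [hzeq] using hmax x hx
    have hcone : -z ∈ posTangentConeAt (closedBall (0 : ℂ) ‖z‖) z := by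
      apply mem_posTangentConeAt_of_segment_subset
      rw [add_neg_cancel]
      exact (convex_closedBall (0 : ℂ) ‖z‖).segment_subset (by simp) (by simp)
    have := hloc.hasFDerivWithinAt_nonpos hf.hasFDerivWithinAt hcone
    simp at this ⊢
    linarith
  · have hcirc : HasDerivAt (fun θ : ℝ => z * exp (θ * I)) (z * I) 0 := by
      have h1 : HasDerivAt (fun θ : ℝ => (θ : ℂ) * I) (1 * I) 0 :=
        (ofRealCLM.hasDerivAt (x := (0 : ℝ))).mul_const I
      simpa using (h1.cexp.const_mul z)
    have hd' : HasDerivAt u (deriv u z) (z * exp ((0 : ℝ) * I)) := by simpa using hd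
    have hc : HasDerivAt (fun θ : ℝ => (u (z * exp (θ * I))).re) (deriv u z * (z * I)).re 0 :=
      reCLM.hasFDerivAt.comp_hasDerivAt (0 : ℝ) (hd'.comp (0 : ℝ) hcirc)
    have hloc : IsLocalMax (fun θ : ℝ => (u (z * exp (θ * I))).re) 0 := by
      refine Filter.Eventually.of_forall fun θ => ?_
      simpa [hzeq] using hmax (z * exp (θ * I)) (by simp [norm_exp_ofReal_mul_I])
    have h := hloc.hasDerivAt_eq_zero hc
    apply Complex.ext
    · simp
    · simp at h ⊢
      linarith

/-- The average of `k` along the radius from `0` to `z` with weight `t ^ n` solves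
`z K' + (n + 1) K = k`. -/
lemma hasDerivAt_radial_average {k : ℂ → ℂ} (hk : DifferentiableOn ℂ k (ball 0 1)) (n : ℕ)
    {z : ℂ} (hz : z ∈ ball (0 : ℂ) 1) :
    ∃ K' : ℂ, HasDerivAt (fun z : ℂ => ∫ t in (0:ℝ)..1, (t : ℂ) ^ n * k (t * z)) K' z ∧
      z * K' + (n + 1) * (∫ t in (0:ℝ)..1, (t : ℂ) ^ n * k (t * z)) = k z := by
  have hk' : ContinuousOn (deriv k) (ball 0 1) := (hk.deriv isOpen_ball).continuousOn
  have hkd : ∀ x ∈ ball (0 : ℂ) 1, HasDerivAt k (deriv k x) x := fun x hx =>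
    (hk.differentiableAt (isOpen_ball.mem_nhds hx)).hasDerivAt
  have hmem : ∀ {t : ℝ} {r : ℝ} {x : ℂ}, t ∈ Icc (0:ℝ) 1 → x ∈ closedBall (0 : ℂ) r →
      (t : ℂ) * x ∈ closedBall (0 : ℂ) r := by
    intro t r x ht hx
    simp only [mem_closedBall, dist_zero_right, norm_mul, norm_real, Real.norm_eq_abs,
      abs_of_nonneg ht.1] at hx ⊢
    exact (mul_le_of_le_one_left (norm_nonneg x) ht.2).trans hx
  obtain ⟨r, hzr, hr1⟩ := exists_between (show ‖z‖ < 1 by simpa using hz)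
  have hrsub : closedBall (0 : ℂ) r ⊆ ball 0 1 := closedBall_subset_ball hr1
  have hcont : ∀ g : ℂ → ℂ, ContinuousOn g (ball 0 1) → ∀ m : ℕ, ∀ x ∈ closedBall (0 : ℂ) r,
      ContinuousOn (fun t : ℝ => (t : ℂ) ^ m * g (t * x)) (Icc 0 1) := by
    intro g hg m x hx
    refine ContinuousOn.mul (by fun_prop) (hg.comp (by fun_prop) fun t ht => hrsub (hmem ht hx))
  have hint : ∀ g : ℂ → ℂ, ContinuousOn g (ball 0 1) → ∀ m : ℕ, ∀ x ∈ closedBall (0 : ℂ) r,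
      IntervalIntegrable (fun t : ℝ => (t : ℂ) ^ m * g (t * x)) MeasureTheory.volume 0 1 := by
    intro g hg m x hx
    exact ContinuousOn.intervalIntegrable_of_Icc zero_le_one (hcont g hg m x hx)
  have hzr' : z ∈ closedBall (0 : ℂ) r := by simpa using hzr.le
  have hnhds : closedBall (0 : ℂ) r ∈ 𝓝 z :=
    Filter.mem_of_superset (isOpen_ball.mem_nhds (by simpa using hzr)) ball_subset_closedBall
  obtain ⟨C, hC⟩ := (isCompact_closedBall (0 : ℂ) r).exists_bound_of_continuousOn (hk'.mono hrsub)
  have huIoc : ∀ {t : ℝ}, t ∈ uIoc (0:ℝ) 1 → t ∈ Icc (0:ℝ) 1 := fun {t} ht => by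
    rw [uIoc_of_le zero_le_one] at ht
    exact Ioc_subset_Icc_self ht
  have key := intervalIntegral.hasDerivAt_integral_of_dominated_loc_of_deriv_le
    (μ := MeasureTheory.volume) (a := 0) (b := 1)
    (F := fun (x : ℂ) (t : ℝ) => (t : ℂ) ^ n * k (t * x))
    (F' := fun (x : ℂ) (t : ℝ) => (t : ℂ) ^ (n + 1) * deriv k (t * x)) (bound := fun _ => C) hnhds
    (Filter.mem_of_superset hnhds fun x hx =>
      (intervalIntegrable_iff.1 (hint k hk.continuousOn n x hx)).aestronglyMeasurable)
    (hint k hk.continuousOn n z hzr')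
    (intervalIntegrable_iff.1 (hint _ hk' (n + 1) z hzr')).aestronglyMeasurable
    (Filter.Eventually.of_forall fun t ht x hx => by
      have ht' := huIoc ht
      rw [norm_mul, norm_pow, norm_real, Real.norm_eq_abs, abs_of_nonneg ht'.1]
      exact (mul_le_of_le_one_left (norm_nonneg _) (pow_le_one₀ ht'.1 ht'.2)).trans
        (hC _ (hmem ht' hx)))
    intervalIntegrable_const
    (Filter.Eventually.of_forall fun t ht x hx => by
      have h := (hkd _ (hrsub (hmem (huIoc ht) hx))).comp x ((hasDerivAt_id x).const_mul (t : ℂ))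
      refine (h.const_mul ((t : ℂ) ^ n)).congr_deriv ?_
      simp only [mul_one]
      ring)
  refine ⟨_, key.2, ?_⟩
  have hftc := intervalIntegral.integral_eq_sub_of_hasDerivAt (a := (0:ℝ)) (b := 1)
    (f := fun t : ℝ => (t : ℂ) ^ (n + 1) * k (t * z))
    (f' := fun t : ℝ => z * ((t : ℂ) ^ (n + 1) * deriv k (t * z))
      + (n + 1) * ((t : ℂ) ^ n * k (t * z)))
    (fun t ht => by
      rw [uIcc_of_le zero_le_one] at ht
      have h1 : HasDerivAt (fun t : ℝ => (t : ℂ)) 1 t := ofRealCLM.hasDerivAt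
      have h2 := (hkd _ (hrsub (hmem ht hzr'))).comp t (h1.mul_const z)
      refine ((h1.fun_pow (n + 1)).mul h2).congr_deriv ?_
      simp only [Function.comp_apply]
      push_cast
      ring)
    (((hint _ hk' (n + 1) z hzr').const_mul z).add
      ((hint k hk.continuousOn n z hzr').const_mul _))
  rw [intervalIntegral.integral_add ((hint _ hk' (n + 1) z hzr').const_mul z)
      ((hint k hk.continuousOn n z hzr').const_mul _), intervalIntegral.integral_const_mul,
      intervalIntegral.integral_const_mul] at hftc
  simpa using hftc

/-- If `z K' + N K = k` and `φ = N + z k' / k` has positive real part, then so does `K / k`. -/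
lemma re_div_pos {k K : ℂ → ℂ} {N : ℂ} (hk : DifferentiableOn ℂ k (ball 0 1))
    (hK : DifferentiableOn ℂ K (ball 0 1)) (hk0 : ∀ z ∈ ball (0 : ℂ) 1, k z ≠ 0)
    (hode : ∀ z ∈ ball (0 : ℂ) 1, z * deriv K z + N * K z = k z)
    (hN : 0 < N.re)
    (hφ : ∀ z ∈ ball (0 : ℂ) 1, z ≠ 0 → 0 < (N + z * deriv k z / k z).re) :
    ∀ z ∈ ball (0 : ℂ) 1, 0 < (K z / k z).re := by
  intro w hw
  by_contra! hneg
  have hN0 : N ≠ 0 := by rintro rfl; simp at hN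
  have h00 : (0 : ℂ) ∈ ball (0 : ℂ) 1 := by simp
  have hK0 : K 0 / k 0 = N⁻¹ := by
    have := hode 0 h00
    have hk := hk0 0 h00
    rw [div_eq_iff hk, ← this]
    field_simp
    simp
  have hpos : 0 < (K 0 / k 0).re := by
    rw [hK0, inv_re]
    exact div_pos hN (normSq_pos.mpr hN0)
  obtain ⟨z, hz, hz0, hre, m, hm, hzm⟩ := exists_first_touch (u := fun z => -(K z / k z)) (b := 0)
    ((hK.div hk hk0).neg) (by simpa using hpos) hw (by simpa using hneg)
  have hkd := (hk.differentiableAt (isOpen_ball.mem_nhds hz)).hasDerivAt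
  have hKd := (hK.differentiableAt (isOpen_ball.mem_nhds hz)).hasDerivAt
  have hkz := hk0 z hz
  have hder : deriv (fun z => -(K z / k z)) z = _ := ((hKd.div hkd hkz).neg).deriv
  rw [hder] at hzm
  have hφz := hφ z hz hz0
  have hrel : (N + z * deriv k z / k z) * (K z / k z) = 1 + m := by
    rw [← hzm]
    have := hode z hz
    field_simp
    linear_combination k z * this
  have hr : (K z / k z).re = 0 := by simpa using hre
  set φ := N + z * deriv k z / k z
  set r := K z / k z
  have e1 := congrArg re hrel
  have e2 := congrArg im hrel
  simp [hr] at e1 e2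
  rcases e2 with h | h
  · exact hφz.ne' h
  · rw [h] at e1
    linarith

/-- Briot–Bouquet subordination for half-planes: if `z K' + N K = k` and `K / k` has positive real
part, then every half-plane containing `φ = N + z k' / k` contains `q = k / K`, since
`φ = q + z q' / q`. -/
lemma re_mul_div_lt {k K : ℂ → ℂ} {N a : ℂ} {b : ℝ} (hk : DifferentiableOn ℂ k (ball 0 1))
    (hK : DifferentiableOn ℂ K (ball 0 1)) (hk0 : ∀ z ∈ ball (0 : ℂ) 1, k z ≠ 0)
    (hode : ∀ z ∈ ball (0 : ℂ) 1, z * deriv K z + N * K z = k z)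
    (hpos : ∀ z ∈ ball (0 : ℂ) 1, 0 < (K z / k z).re)
    (hN : (a * N).re < b)
    (hφ : ∀ z ∈ ball (0 : ℂ) 1, z ≠ 0 → (a * (N + z * deriv k z / k z)).re < b) :
    ∀ z ∈ ball (0 : ℂ) 1, (a * (k z / K z)).re < b := by
  intro w hw
  by_contra! hge
  have hK0 : ∀ z ∈ ball (0 : ℂ) 1, K z ≠ 0 := fun z hz h => by simpa [h] using hpos z hz
  have h00 : (0 : ℂ) ∈ ball (0 : ℂ) 1 := by simp
  have hq0 : k 0 / K 0 = N := by
    rw [div_eq_iff (hK0 0 h00), ← hode 0 h00]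
    ring
  obtain ⟨z, hz, hz0, hre, m, hm, hzm⟩ := exists_first_touch (u := fun z => a * (k z / K z))
    ((hk.div hK hK0).const_mul a) (by simpa [hq0] using hN) hw hge
  have hkd := (hk.differentiableAt (isOpen_ball.mem_nhds hz)).hasDerivAt
  have hKd := (hK.differentiableAt (isOpen_ball.mem_nhds hz)).hasDerivAt
  have hkz := hk0 z hz
  have hKz := hK0 z hz
  have hder : deriv (fun z => a * (k z / K z)) z = _ := ((hkd.div hKd hKz).const_mul a).deriv
  rw [hder] at hzm
  have hrel : a * (N + z * deriv k z / k z) = a * (k z / K z) + m * (K z / k z) := by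
    rw [← hzm]
    have := hode z hz
    field_simp
    linear_combination a * k z * this
  have h1 := hφ z hz hz0
  rw [hrel, add_re, re_ofReal_mul, hre] at h1
  have h2 := mul_nonneg hm (hpos z hz).le
  linarith

/-- For `f = z ^ p * g`, `ksG` is `z ^ (p * α)` times a radial average of `g ^ α`. -/
lemma ksG_eq {p α c n : ℕ} {f g : ℂ → ℂ} (hn : n + 1 = c + p * α)
    (hfg : ∀ z ∈ ball (0 : ℂ) 1, f z = z ^ p * g z) {z : ℂ} (hz : z ∈ ball (0 : ℂ) 1)
    (hz0 : z ≠ 0) :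
    ksG p α c f z =
      (n + 1) * (z ^ (p * α) * ∫ t in (0:ℝ)..1, (t : ℂ) ^ n * (g (t * z)) ^ α) := by
  have hint : ∫ t in (0:ℝ)..1, ((t : ℂ) * z) ^ c * (f ((t : ℂ) * z)) ^ α / ((t : ℂ) * z) =
      z ^ n * ∫ t in (0:ℝ)..1, (t : ℂ) ^ n * (g (t * z)) ^ α := by
    rw [← intervalIntegral.integral_const_mul]
    refine intervalIntegral.integral_congr_ae (Filter.Eventually.of_forall fun t ht => ?_)
    rw [uIoc_of_le zero_le_one] at ht
    have ht0 : (t : ℂ) ≠ 0 := by exact_mod_cast ht.1.ne'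
    have hmem : (t : ℂ) * z ∈ ball (0 : ℂ) 1 := by
      simp only [mem_ball, dist_zero_right, norm_mul, norm_real, Real.norm_eq_abs,
        abs_of_pos ht.1] at hz ⊢
      exact (mul_le_of_le_one_left (norm_nonneg z) ht.2).trans_lt hz
    rw [hfg _ hmem, div_eq_iff (mul_ne_zero ht0 hz0)]
    have : ((t : ℂ) * z) ^ (c + p * α) = (t * z) ^ (n + 1) := by rw [hn]
    rw [pow_add, pow_mul] at this
    rw [mul_pow _ (g _), ← mul_assoc, this]
    ring
  have hz' : z ^ (n + 1) = z ^ c * z ^ (p * α) := by rw [hn, pow_add]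
  have hnC : (n : ℂ) + 1 = c + p * α := by exact_mod_cast hn
  rw [ksG, if_neg hz0, hint, ← mul_assoc z, ← pow_succ', hz', hnC]
  generalize ∫ t in (0:ℝ)..1, (t : ℂ) ^ n * (g (t * z)) ^ α = J
  field_simp

/-- Theorem 5.1. For integers `p, α ≥ 1`, `c ≥ 0` and a convex univalent `Ψ`
with `Ψ(0) = p` and `Re Ψ > −c/α`, the Kumar–Shukla operator `T(·; p, α, c)` preserves the class
`ℱ = {f ∈ 𝔄(p) : z f'/f ≺ Ψ}`: with `G = T(f; p, α, c)^α`, one has `(1/α)(z G'/G) ∈ Ψ(𝔻)`. -/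
theorem kumarShukla_preserves (p α c : ℕ) (hp : 1 ≤ p) (hα : 1 ≤ α)
    (Ψ : ℂ → ℂ) (hΨa : AnalyticOnNhd ℂ Ψ (ball 0 1))
    (hΨi : Set.InjOn Ψ (ball 0 1)) (hΨc : Convex ℝ (Ψ '' ball 0 1))
    (hΨ0 : Ψ 0 = (p : ℂ)) (hΨre : ∀ z ∈ ball (0 : ℂ) 1, -((c : ℝ) / α) < (Ψ z).re)
    (f : ℂ → ℂ) (hf : AnalyticOnNhd ℂ f (ball 0 1))
    (hord : ∃ g : ℂ → ℂ, AnalyticOnNhd ℂ g (ball 0 1) ∧ g 0 ≠ 0 ∧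
      ∀ z ∈ ball (0 : ℂ) 1, f z = z ^ p * g z)
    (hsub : ∀ z ∈ ball (0 : ℂ) 1, z ≠ 0 →
      f z ≠ 0 ∧ z * deriv f z / f z ∈ Ψ '' ball 0 1) :
    ∀ z ∈ ball (0 : ℂ) 1, z ≠ 0 →
      ksG p α c f z ≠ 0 ∧
        (1 / (α : ℂ)) * (z * deriv (ksG p α c f) z / ksG p α c f z) ∈ Ψ '' ball 0 1 := by
  obtain ⟨g, hg, hg0, hfg⟩ := hord
  obtain ⟨n, hn⟩ : ∃ n, n + 1 = c + p * α :=
    ⟨c + p * α - 1, Nat.sub_add_cancel (by nlinarith [Nat.mul_le_mul hp hα])⟩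
  have hnC : (n : ℂ) + 1 = c + p * α := by exact_mod_cast hn
  have hαC : (α : ℂ) ≠ 0 := by exact_mod_cast (by lia : α ≠ 0)
  have hαR : (0 : ℝ) < α := by exact_mod_cast hα
  have h00 : (0 : ℂ) ∈ ball (0 : ℂ) 1 := by simp
  have hgne : ∀ z ∈ ball (0 : ℂ) 1, g z ≠ 0 := fun z hz h => by
    by_cases hz0 : z = 0
    · exact hg0 (hz0 ▸ h)
    · exact (hsub z hz hz0).1 (by rw [hfg z hz, h, mul_zero])
  set k : ℂ → ℂ := fun z => g z ^ α with hkdef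
  set K : ℂ → ℂ := fun z => ∫ t in (0:ℝ)..1, (t : ℂ) ^ n * k (t * z) with hKdef
  have hgd : DifferentiableOn ℂ g (ball 0 1) := hg.differentiableOn
  have hk : DifferentiableOn ℂ k (ball 0 1) := hgd.pow α
  have hk0 : ∀ z ∈ ball (0 : ℂ) 1, k z ≠ 0 := fun z hz => pow_ne_zero _ (hgne z hz)
  have hK : DifferentiableOn ℂ K (ball 0 1) := fun z hz => by
    obtain ⟨K', hK', -⟩ := hasDerivAt_radial_average hk n hz
    exact hK'.differentiableAt.differentiableWithinAt
  have hode : ∀ z ∈ ball (0 : ℂ) 1, z * deriv K z + (n + 1) * K z = k z := fun z hz => by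
    obtain ⟨K', hK', h⟩ := hasDerivAt_radial_average hk n hz
    rw [hK'.deriv]
    exact h
  have hφ : ∀ z ∈ ball (0 : ℂ) 1, z ≠ 0 →
      (n + 1) + z * deriv k z / k z = c + α * (z * deriv f z / f z) := by
    intro z hz hz0
    have hgz := (hgd.differentiableAt (isOpen_ball.mem_nhds hz)).hasDerivAt
    have hfd : deriv f z = p * z ^ (p - 1) * g z + z ^ p * deriv g z := by
      have heq : f =ᶠ[𝓝 z] fun z => z ^ p * g z :=
        Filter.mem_of_superset (isOpen_ball.mem_nhds hz) hfg
      rw [heq.deriv_eq]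
      exact ((hasDerivAt_pow p z).mul hgz).deriv
    have hkd : deriv k z = α * g z ^ (α - 1) * deriv g z := (hgz.fun_pow α).deriv
    have hgz0 := hgne z hz
    obtain ⟨a, rfl⟩ : ∃ a, α = a + 1 := ⟨α - 1, by lia⟩
    obtain ⟨s, rfl⟩ : ∃ s, p = s + 1 := ⟨p - 1, by lia⟩
    rw [hnC, hkd, hfd, hfg z hz, hkdef]
    simp only [Nat.add_sub_cancel]
    field_simp
    ring
  have hpos : ∀ z ∈ ball (0 : ℂ) 1, 0 < (K z / k z).re := by
    refine re_div_pos hk hK hk0 hode ?_ fun z hz hz0 => ?_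
    · rw [add_re, natCast_re, one_re]
      positivity
    · obtain ⟨w, hw, hwe⟩ := (hsub z hz hz0).2
      have h := hΨre w hw
      rw [hφ z hz hz0, ← hwe, add_re, natCast_re, ← ofReal_natCast α, re_ofReal_mul]
      rw [← neg_div, div_lt_iff₀ hαR] at h
      linarith
  have hopen : IsOpen (Ψ '' ball 0 1) := by
    refine (hΨa.is_constant_or_isOpen (convex_ball (0 : ℂ) 1).isPreconnected).resolve_left ?_ _
      subset_rfl isOpen_ball
    rintro ⟨w, hw⟩
    have hhalf : (1 / 2 : ℂ) ∈ ball (0 : ℂ) 1 := by simp; norm_num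
    have := hΨi hhalf h00 ((hw _ hhalf).trans (hw _ h00).symm)
    norm_num at this
  intro z hz hz0
  have hKz : K z ≠ 0 := fun h => by simpa [h] using hpos z hz
  have hNne : (n : ℂ) + 1 ≠ 0 := by exact_mod_cast n.succ_ne_zero
  have hGz := ksG_eq hn hfg hz hz0
  have hGd : deriv (ksG p α c f) z =
      (n + 1) * ((p * α : ℕ) * z ^ (p * α - 1) * K z + z ^ (p * α) * deriv K z) := by
    have heq : ksG p α c f =ᶠ[𝓝 z] fun z => (n + 1) * (z ^ (p * α) * K z) := by
      filter_upwards [isOpen_ball.mem_nhds hz, isOpen_ne.mem_nhds hz0] with x hx hx0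
      exact ksG_eq hn hfg hx hx0
    rw [heq.deriv_eq]
    exact (((hasDerivAt_pow (p * α) z).mul
      (hK.differentiableAt (isOpen_ball.mem_nhds hz)).hasDerivAt).const_mul _).deriv
  change _ = (n + 1) * (z ^ (p * α) * K z) at hGz
  refine ⟨by rw [hGz]; exact mul_ne_zero hNne (mul_ne_zero (pow_ne_zero _ hz0) hKz), ?_⟩
  have hlog : z * deriv (ksG p α c f) z / ksG p α c f z = k z / K z - c := by
    obtain ⟨s, hs⟩ : ∃ s, p * α = s + 1 :=
      ⟨p * α - 1, (Nat.sub_add_cancel (Nat.mul_le_mul hp hα)).symm⟩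
    have hsC : (p : ℂ) * α = s + 1 := by exact_mod_cast hs
    rw [hGd, hGz, ← hode z hz, hnC, hs, hsC]
    rw [hnC, hsC] at hNne
    push_cast
    field_simp
    ring
  rw [hlog]
  by_contra hnot
  obtain ⟨l, hl⟩ := geometric_hahn_banach_open_point hΨc hopen hnot
  obtain ⟨a, ha⟩ : ∃ a : ℂ, ∀ w, l w = (a * w).re := by
    refine ⟨l 1 - l I * I, fun w => ?_⟩
    have : w = w.re • (1 : ℂ) + w.im • I := by simp
    conv_lhs => rw [this, map_add, map_smul, map_smul]
    simp
    ring
  have hconv : ∀ w : ℂ, c + α * w ∈ (fun x : ℂ => c + α * x) '' (Ψ '' ball 0 1) →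
      (a / α * (c + α * w)).re < (a / α * (k z / K z)).re := by
    rintro w ⟨x, hx, hxw⟩
    have hxw' : x = w := mul_left_cancel₀ hαC (add_left_cancel hxw)
    subst hxw'
    have h := hl x hx
    rw [ha, ha] at h
    have e1 : a / α * (c + α * x) = a / α * c + a * x := by field_simp
    have e2 : a / α * (k z / K z) = a / α * c + a * (1 / α * (k z / K z - c)) := by
      field_simp
      ring
    rw [e1, e2, add_re, add_re]
    linarith
  refine lt_irrefl _ (re_mul_div_lt (a := a / α) (b := (a / α * (k z / K z)).re) hk hK hk0 hode
    hpos ?_ (fun x hx hx0 => ?_) z hz)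
  · rw [hnC, mul_comm (p : ℂ)]
    exact hconv p ⟨p, ⟨0, h00, hΨ0⟩, rfl⟩
  · rw [hφ x hx hx0]
    exact hconv _ ⟨_, (hsub x hx hx0).2, rfl⟩
end

section
/- Let 0 < β ≤ 1 and let c ≥ 0 be an integer. If f is a normalized analytic function on 𝔻 that is strongly starlike of order β, i.e., f(z) ≠ 0, z·f'(z)/f(z) ≠ 0, and |arg( z·f'(z)/f(z) )| < βπ/2 for all z ∈ 𝔻 \ {0}, then its Bernardi transform F = B_c(f) is also strongly starlike of order β: F(z) ≠ 0, z·F'(z)/F(z) ≠ 0, and |arg( z·F'(z)/F(z) )| < βπ/2 for all z ∈ 𝔻 \ {0}. Hence B_c(SS*(β)) ⊆ SS*(β). -/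
open Complex Metric Set

/-- For a function differentiable on the unit disk, a point where `Re φ ≤ 0` yields a point
minimizing `Re φ` on a closed disk, at which `z φ'(z)` is a nonpositive real number. Excluding
such points forces `Re φ > 0`. -/
lemma re_pos_of_extremal {φ : ℂ → ℂ} (hφ : DifferentiableOn ℂ φ (ball 0 1))
    (h0 : 0 < (φ 0).re)
    (h : ∀ z ∈ ball (0 : ℂ) 1, z ≠ 0 → ∀ s : ℝ, s ≤ 0 → z * deriv φ z = s → 0 < (φ z).re) :
    ∀ z ∈ ball (0 : ℂ) 1, 0 < (φ z).re := by
  intro w hw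
  by_contra! hneg
  have hsub : closedBall (0 : ℂ) ‖w‖ ⊆ ball 0 1 :=
    closedBall_subset_ball (by simpa using hw)
  obtain ⟨z, hz, hmin⟩ := (isCompact_closedBall (0 : ℂ) ‖w‖).exists_isMinOn
    ⟨w, by simp⟩ (continuous_re.comp_continuousOn (hφ.continuousOn.mono hsub))
  have hzre : (φ z).re ≤ 0 := (hmin (by simp : w ∈ closedBall (0 : ℂ) ‖w‖)).trans hneg
  have hz0 : z ≠ 0 := by
    rintro rfl
    exact absurd h0 hzre.not_gt
  have hderiv : HasDerivAt φ (deriv φ z) z :=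
    (hφ.differentiableAt (isOpen_ball.mem_nhds (hsub hz))).hasDerivAt
  have him : (z * deriv φ z).im = 0 := by
    have hcurve : HasDerivAt (fun t : ℝ => z * exp (t * I)) (z * I) 0 := by
      have h1 : HasDerivAt (fun t : ℝ => (t : ℂ) * I) I 0 := by
        simpa using (ofRealCLM.hasDerivAt (x := 0)).mul_const I
      simpa using h1.cexp.const_mul z
    have hcomp : HasDerivAt (fun t : ℝ => φ (z * exp (t * I))) (deriv φ z * (z * I)) 0 :=
      HasDerivAt.comp (0 : ℝ) (by simpa using hderiv) hcurve
    have hre : HasDerivAt (fun t : ℝ => (φ (z * exp (t * I))).re)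
        (deriv φ z * (z * I)).re 0 := reCLM.hasFDerivAt.comp_hasDerivAt (0 : ℝ) hcomp
    have hloc : IsLocalMin (fun t : ℝ => (φ (z * exp (t * I))).re) 0 := by
      refine Filter.Eventually.of_forall fun t => ?_
      have hmem : z * exp (t * I) ∈ closedBall (0 : ℂ) ‖w‖ := by
        simpa [norm_exp_ofReal_mul_I] using hz
      simpa using hmin hmem
    have := hloc.hasDerivAt_eq_zero hre
    simp only [mul_re, mul_im, I_re, I_im] at this ⊢
    linarith
  have hle : (z * deriv φ z).re ≤ 0 := by
    have hcurve : HasDerivAt (fun t : ℝ => z * (t : ℂ)) z 1 := by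
      simpa using (ofRealCLM.hasDerivAt (x := 1)).const_mul z
    have hcomp : HasDerivAt (fun t : ℝ => φ (z * (t : ℂ))) (deriv φ z * z) 1 :=
      HasDerivAt.comp (1 : ℝ) (by simpa using hderiv) hcurve
    have hre : HasDerivAt (fun t : ℝ => (φ (z * (t : ℂ))).re)
        (deriv φ z * z).re 1 := reCLM.hasFDerivAt.comp_hasDerivAt (1 : ℝ) hcomp
    rw [mul_comm]
    have htend := hre.hasDerivWithinAt (s := Iio 1)
    rw [hasDerivWithinAt_iff_tendsto_slope' (by simp)] at htend
    refine le_of_tendsto htend ?_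
    filter_upwards [Ioo_mem_nhdsLT (zero_lt_one' ℝ)] with t ht
    have hmem : z * (t : ℂ) ∈ closedBall (0 : ℂ) ‖w‖ := by
      have hz' : ‖z‖ ≤ ‖w‖ := by simpa using hz
      have : ‖z‖ * |t| ≤ ‖w‖ := by
        rw [abs_of_pos ht.1]
        nlinarith [norm_nonneg z, ht.1, ht.2]
      simpa using this
    have hval : (φ z).re ≤ (φ (z * (t : ℂ))).re := hmin hmem
    rw [slope_def_field]
    refine div_nonpos_of_nonneg_of_nonpos ?_ (by linarith [ht.2])
    simpa using hval
  refine absurd (h z (hsub hz) hz0 (z * deriv φ z).re hle ?_) hzre.not_gt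
  exact Complex.ext (by simp) (by simpa using him)

/-- The open sector of half-angle `βπ/2` is an intersection of two half-planes. -/
lemma abs_arg_lt_iff {β : ℝ} (hβ0 : 0 < β) (hβ1 : β ≤ 1) {w : ℂ} (hw : w ≠ 0) :
    |arg w| < β * Real.pi / 2 ↔
      0 < (exp (((1 - β) * Real.pi / 2 : ℝ) * I) * w).re ∧
        0 < (exp ((-((1 - β) * Real.pi / 2) : ℝ) * I) * w).re := by
  have key : ∀ θ : ℝ, 0 < (exp (θ * I) * w).re ↔ 0 < Real.cos (θ + arg w) := by
    intro θ
    have : exp (θ * I) * w = ‖w‖ * exp ((θ + arg w : ℝ) * I) := by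
      conv_lhs => rw [← norm_mul_exp_arg_mul_I w]
      rw [mul_left_comm, ← exp_add]
      push_cast
      ring_nf
    rw [this, re_ofReal_mul, exp_ofReal_mul_I_re]
    exact mul_pos_iff_of_pos_left (norm_pos_iff.mpr hw)
  rw [key, key]
  have hpi := Real.pi_pos
  have hβpi : 0 < β * Real.pi := mul_pos hβ0 hpi
  have hβpi' : β * Real.pi ≤ Real.pi := by nlinarith
  have hθ : (1 - β) * Real.pi / 2 = Real.pi / 2 - β * Real.pi / 2 := by ring
  rw [hθ]
  constructor
  · intro h
    obtain ⟨h1, h2⟩ := abs_lt.mp h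
    exact ⟨Real.cos_pos_of_mem_Ioo ⟨by linarith, by linarith⟩,
      Real.cos_pos_of_mem_Ioo ⟨by linarith, by linarith⟩⟩
  · rintro ⟨h1, h2⟩
    rw [abs_lt]
    constructor
    · by_contra! hcon
      refine absurd h2 (not_lt.mpr ?_)
      rw [← Real.cos_neg]
      exact Real.cos_nonpos_of_pi_div_two_le_of_le (by linarith)
        (by linarith [neg_pi_lt_arg w])
    · by_contra! hcon
      exact absurd h1 (not_lt.mpr (Real.cos_nonpos_of_pi_div_two_le_of_le (by linarith)
        (by linarith [arg_le_pi w])))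

/-- The mean `∫₀¹ tᶜ g(tz) dt`. -/
noncomputable def powMean (c : ℕ) (g : ℂ → ℂ) (z : ℂ) : ℂ :=
  ∫ t in (0 : ℝ)..1, (t : ℂ) ^ c * g ((t : ℂ) * z)

lemma ofReal_mul_mem_ball {t : ℝ} (ht : t ∈ uIcc (0 : ℝ) 1) {r : ℝ} {z : ℂ}
    (hz : z ∈ ball (0 : ℂ) r) : (t : ℂ) * z ∈ ball (0 : ℂ) r := by
  rw [uIcc_of_le zero_le_one] at ht
  have hz' : ‖z‖ < r := by simpa using hz
  have : |t| * ‖z‖ < r := by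
    rw [abs_of_nonneg ht.1]
    nlinarith [norm_nonneg z, ht.1, ht.2]
  simpa using this

lemma continuousOn_pow_mul_comp {k : ℂ → ℂ} (hk : ContinuousOn k (ball 0 1)) (n : ℕ) {z : ℂ}
    (hz : z ∈ ball (0 : ℂ) 1) :
    ContinuousOn (fun t : ℝ => (t : ℂ) ^ n * k ((t : ℂ) * z)) (uIcc 0 1) := by
  refine ContinuousOn.mul (by fun_prop) ?_
  exact hk.comp (by fun_prop) fun t ht => ofReal_mul_mem_ball ht hz

lemma hasDerivAt_powMean {g : ℂ → ℂ} (hg : DifferentiableOn ℂ g (ball 0 1)) (c : ℕ) {z : ℂ}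
    (hz : z ∈ ball (0 : ℂ) 1) :
    HasDerivAt (powMean c g) (powMean (c + 1) (deriv g) z) z := by
  have hg' : ContinuousOn (deriv g) (ball 0 1) := (hg.deriv isOpen_ball).continuousOn
  obtain ⟨r, hzr, hr1⟩ := exists_between (show ‖z‖ < 1 by simpa using hz)
  have hsub : closedBall (0 : ℂ) r ⊆ ball 0 1 := closedBall_subset_ball hr1
  obtain ⟨M, hM⟩ := (isCompact_closedBall (0 : ℂ) r).exists_bound_of_continuousOn
    (hg'.mono hsub)
  have hsub' : ball (0 : ℂ) r ⊆ ball 0 1 := ball_subset_ball hr1.le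
  have hnhds : ball (0 : ℂ) r ∈ nhds z := isOpen_ball.mem_nhds (by simpa using hzr)
  refine (intervalIntegral.hasDerivAt_integral_of_dominated_loc_of_deriv_le
    (F := fun x t => ((t : ℝ) : ℂ) ^ c * g ((t : ℂ) * x))
    (F' := fun x t => ((t : ℝ) : ℂ) ^ (c + 1) * deriv g ((t : ℂ) * x))
    (bound := fun _ => M) hnhds ?_ ?_ ?_ ?_ (by simp) ?_).2
  · filter_upwards [hnhds] with x hx
    exact ((continuousOn_pow_mul_comp hg.continuousOn c (hsub' hx)).intervalIntegrable
      ).def'.aestronglyMeasurable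
  · exact (continuousOn_pow_mul_comp hg.continuousOn c hz).intervalIntegrable
  · exact ((continuousOn_pow_mul_comp hg' (c + 1) hz).intervalIntegrable
      ).def'.aestronglyMeasurable
  · refine Filter.Eventually.of_forall fun t ht x hx => ?_
    have ht' := uIoc_subset_uIcc ht
    have hb := hM _ (ball_subset_closedBall (ofReal_mul_mem_ball ht' hx))
    rw [uIcc_of_le zero_le_one] at ht'
    have hpow : ‖(t : ℂ) ^ (c + 1)‖ ≤ 1 := by
      rw [norm_pow, norm_real, Real.norm_eq_abs, abs_of_nonneg ht'.1]
      exact pow_le_one₀ ht'.1 ht'.2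
    rw [norm_mul]
    exact (mul_le_of_le_one_left (norm_nonneg _) hpow).trans hb
  · refine Filter.Eventually.of_forall fun t ht x hx => ?_
    have hmem := hsub' (ofReal_mul_mem_ball (uIoc_subset_uIcc ht) hx)
    have h1 := (hg.differentiableAt (isOpen_ball.mem_nhds hmem)).hasDerivAt
    have h2 : HasDerivAt (fun x : ℂ => (t : ℂ) * x) (t : ℂ) x := by
      simpa using (hasDerivAt_id x).const_mul (t : ℂ)
    have h3 : HasDerivAt (fun x : ℂ => g ((t : ℂ) * x)) (deriv g ((t : ℂ) * x) * t) x :=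
      HasDerivAt.comp x h1 h2
    have h4 := h3.const_mul ((t : ℂ) ^ c)
    rwa [mul_comm (deriv g _), ← mul_assoc, ← pow_succ] at h4

/-- Integration by parts: `z G' + (c + 1) G = g` for the mean `G` of `g`. -/
lemma mul_powMean_deriv_add {g : ℂ → ℂ} (hg : DifferentiableOn ℂ g (ball 0 1)) (c : ℕ) {z : ℂ}
    (hz : z ∈ ball (0 : ℂ) 1) :
    z * powMean (c + 1) (deriv g) z + (c + 1) * powMean c g z = g z := by
  have hg' : ContinuousOn (deriv g) (ball 0 1) := (hg.deriv isOpen_ball).continuousOn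
  have hi1 := (continuousOn_pow_mul_comp hg' (c + 1) hz).intervalIntegrable
    (μ := MeasureTheory.volume)
  have hi2 := (continuousOn_pow_mul_comp hg.continuousOn c hz).intervalIntegrable
    (μ := MeasureTheory.volume)
  have hftc := intervalIntegral.integral_eq_sub_of_hasDerivAt
    (f := fun t : ℝ => (t : ℂ) ^ (c + 1) * g ((t : ℂ) * z))
    (f' := fun t : ℝ => z * ((t : ℂ) ^ (c + 1) * deriv g ((t : ℂ) * z)) +
      (c + 1) * ((t : ℂ) ^ c * g ((t : ℂ) * z))) (a := 0) (b := 1) ?_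
    ((hi1.const_mul z).add (hi2.const_mul _))
  · rw [intervalIntegral.integral_add (hi1.const_mul z) (hi2.const_mul _),
      intervalIntegral.integral_const_mul, intervalIntegral.integral_const_mul] at hftc
    simpa [powMean] using hftc
  · intro t ht
    have hmem := ofReal_mul_mem_ball ht hz
    have h1 := (hg.differentiableAt (isOpen_ball.mem_nhds hmem)).hasDerivAt
    have h0 : HasDerivAt (fun t : ℝ => (t : ℂ)) 1 t := ofRealCLM.hasDerivAt
    have h3 : HasDerivAt (fun t : ℝ => g ((t : ℂ) * z)) (deriv g ((t : ℂ) * z) * (1 * z)) t :=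
      HasDerivAt.comp t h1 (h0.mul_const z)
    refine ((h0.pow (c + 1)).mul h3).congr_deriv ?_
    simp only [Nat.cast_add, Nat.cast_one, Nat.add_sub_cancel, Pi.pow_apply]
    ring

lemma bernardi_eq (c : ℕ) {f : ℂ → ℂ} (hf0 : f 0 = 0) (z : ℂ) :
    bernardi c f z = (1 + c) * (z * powMean c (dslope f 0) z) := by
  by_cases hz : z = 0
  · simp [bernardi, hz]
  have hint : ∀ t : ℝ, bernardiIntegrand c f (t * z) =
      z ^ c * ((t : ℂ) ^ c * dslope f 0 (t * z)) := by
    intro t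
    have hd : (if (t : ℂ) * z = 0 then deriv f 0 else f (t * z) / (t * z)) =
        dslope f 0 (t * z) := by
      split_ifs with h
      · rw [h, dslope_same]
      · rw [dslope_of_ne _ h, slope_def_field, hf0, sub_zero, sub_zero]
    rw [bernardiIntegrand, hd]
    ring
  have hzc : z ^ c ≠ 0 := pow_ne_zero c hz
  rw [bernardi, if_neg hz, segIntegral]
  simp_rw [hint]
  rw [intervalIntegral.integral_const_mul, powMean]
  field_simp

/-- For `0 < β ≤ 1` and `c = 0, 1, 2, ⋯`, the Bernardi transform preserves
the class `SS*(β)` of strongly starlike functions of order `β`. -/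
theorem bernardi_preserves_strongly_starlike (β : ℝ) (hβ0 : 0 < β) (hβ1 : β ≤ 1) (c : ℕ)
    (f : ℂ → ℂ) (hf : AnalyticOnNhd ℂ f (ball 0 1)) (hf0 : f 0 = 0) (hf1 : deriv f 0 = 1)
    (hstar : ∀ z ∈ ball (0 : ℂ) 1, z ≠ 0 →
      f z ≠ 0 ∧ z * deriv f z / f z ≠ 0 ∧
        |Complex.arg (z * deriv f z / f z)| < β * Real.pi / 2) :
    ∀ z ∈ ball (0 : ℂ) 1, z ≠ 0 →
      bernardi c f z ≠ 0 ∧ z * deriv (bernardi c f) z / bernardi c f z ≠ 0 ∧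
        |Complex.arg (z * deriv (bernardi c f) z / bernardi c f z)| < β * Real.pi / 2 := by
  have hstar' : ∀ z ∈ ball (0 : ℂ) 1, z ≠ 0 → ∀ θ : ℝ,
      θ = (1 - β) * Real.pi / 2 ∨ θ = -((1 - β) * Real.pi / 2) →
        0 < (exp (θ * I) * (z * deriv f z / f z)).re := by
    rintro z hz hz0 θ (rfl | rfl)
    · exact ((abs_arg_lt_iff hβ0 hβ1 (hstar z hz hz0).2.1).mp (hstar z hz hz0).2.2).1
    · exact ((abs_arg_lt_iff hβ0 hβ1 (hstar z hz hz0).2.1).mp (hstar z hz hz0).2.2).2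
  have hpre : ∀ z ∈ ball (0 : ℂ) 1, z ≠ 0 → 0 < (z * deriv f z / f z).re := by
    intro z hz hz0
    have h1 : |arg (z * deriv f z / f z)| < Real.pi / 2 :=
      (hstar z hz hz0).2.2.trans_le (by nlinarith [Real.pi_pos])
    exact (abs_arg_lt_pi_div_two_iff.mp h1).resolve_right (hstar z hz hz0).2.1
  set g := dslope f 0 with hgdef
  have hfg : ∀ z, f z = z * g z := by
    intro z
    simpa [hf0] using (sub_smul_dslope f 0 z).symm
  have hgd : DifferentiableOn ℂ g (ball 0 1) :=
    (differentiableOn_dslope (isOpen_ball.mem_nhds (by simp))).mpr hf.differentiableOn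
  have hg0 : g 0 = 1 := by rw [hgdef, dslope_same, hf1]
  have hgne : ∀ z ∈ ball (0 : ℂ) 1, g z ≠ 0 := by
    intro z hz h
    by_cases hz0 : z = 0
    · simp [hz0, hg0] at h
    · exact (hstar z hz hz0).1 (by rw [hfg, h, mul_zero])
  have hgD : ∀ z ∈ ball (0 : ℂ) 1, HasDerivAt g (deriv g z) z := fun z hz =>
    (hgd.differentiableAt (isOpen_ball.mem_nhds hz)).hasDerivAt
  have hp : ∀ z ∈ ball (0 : ℂ) 1, z ≠ 0 →
      z * deriv f z / f z = 1 + z * deriv g z / g z := by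
    intro z hz hz0
    have h1 : HasDerivAt f (1 * g z + z * deriv g z) z := by
      rw [funext hfg]
      exact (hasDerivAt_id z).mul (hgD z hz)
    rw [h1.deriv, hfg]
    have := hgne z hz
    field_simp
  set G := powMean c g with hGdef
  set G' := powMean (c + 1) (deriv g)
  have hGD : ∀ z ∈ ball (0 : ℂ) 1, HasDerivAt G (G' z) z := fun z hz =>
    hasDerivAt_powMean hgd c hz
  have hode : ∀ z ∈ ball (0 : ℂ) 1, z * G' z + (c + 1) * G z = g z := fun z hz =>
    mul_powMean_deriv_add hgd c hz
  have hc : (c + 1 : ℂ) ≠ 0 := by exact_mod_cast c.succ_ne_zero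
  have hG0 : G 0 = 1 / (c + 1) := by
    have := hode 0 (by simp)
    rw [hg0, zero_mul, zero_add] at this
    rw [eq_div_iff hc, mul_comm, this]
  have hratio : ∀ z ∈ ball (0 : ℂ) 1, 0 < (G z / g z).re := by
    have hD : ∀ z ∈ ball (0 : ℂ) 1, HasDerivAt (fun z => G z / g z)
        ((G' z * g z - G z * deriv g z) / g z ^ 2) z := fun z hz =>
      (hGD z hz).div (hgD z hz) (hgne z hz)
    refine re_pos_of_extremal (φ := fun z => G z / g z)
      (fun z hz => (hD z hz).differentiableAt.differentiableWithinAt) ?_ ?_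
    · have : ((1 : ℂ) / (c + 1)) = ((1 / (c + 1) : ℝ) : ℂ) := by push_cast; rfl
      simp only [hG0, hg0, div_one]
      rw [this, ofReal_re]
      positivity
    · intro z hz hz0 s hs hzs
      rw [(hD z hz).deriv] at hzs
      have hgz := hgne z hz
      have hP := hpre z hz hz0
      set P := z * deriv f z / f z
      have hPc : 0 < (P + c).re := by
        have : (0 : ℝ) ≤ c := c.cast_nonneg
        simp only [add_re, natCast_re]
        linarith
      have hPc0 : P + c ≠ 0 := fun h => by simp [h] at hPc
      have hval : (P + c) * (G z / g z) = ((1 - s : ℝ) : ℂ) := by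
        push_cast
        rw [← hzs, show P = 1 + z * deriv g z / g z from hp z hz hz0]
        field_simp
        linear_combination g z * hode z hz
      have hval' : G z / g z = ((1 - s : ℝ) : ℂ) * (P + c)⁻¹ := by
        rw [← hval]
        field_simp
      rw [hval', re_ofReal_mul, inv_re]
      exact mul_pos (by linarith) (div_pos hPc (normSq_pos.mpr hPc0))
  have hGne : ∀ z ∈ ball (0 : ℂ) 1, G z ≠ 0 := by
    intro z hz h
    simpa [h] using hratio z hz
  have hqD : ∀ z ∈ ball (0 : ℂ) 1, HasDerivAt (fun z => g z / G z - c)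
      ((deriv g z * G z - g z * G' z) / G z ^ 2) z := fun z hz =>
    ((hgD z hz).div (hGD z hz) (hGne z hz)).sub_const _
  have hsector : ∀ θ : ℝ,
      θ = (1 - β) * Real.pi / 2 ∨ θ = -((1 - β) * Real.pi / 2) →
        ∀ z ∈ ball (0 : ℂ) 1, 0 < (exp (θ * I) * (g z / G z - c)).re := by
    intro θ hθ
    refine re_pos_of_extremal (φ := fun z => exp (θ * I) * (g z / G z - c))
      (fun z hz => ((hqD z hz).const_mul _).differentiableAt.differentiableWithinAt) ?_ ?_
    · have h1 : g 0 / G 0 - c = 1 := by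
        rw [hG0, hg0]
        simp
      simp only [h1, mul_one, exp_ofReal_mul_I_re]
      refine Real.cos_pos_of_mem_Ioo ?_
      have := Real.pi_pos
      have := mul_pos hβ0 this
      have : β * Real.pi ≤ Real.pi := by nlinarith
      rcases hθ with rfl | rfl <;> constructor <;> linarith
    · intro z hz hz0 s hs hzs
      rw [((hqD z hz).const_mul (exp (θ * I))).deriv] at hzs
      have hgz := hgne z hz
      have hGz := hGne z hz
      have hP := hstar' z hz hz0 θ hθ
      rw [hp z hz hz0] at hP
      have hval : exp (θ * I) * (g z / G z - c) =
          exp (θ * I) * (1 + z * deriv g z / g z) - s * (G z / g z) := by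
        rw [← hzs]
        field_simp
        linear_combination -g z * hode z hz
      simp only [hval, sub_re, re_ofReal_mul]
      nlinarith [hratio z hz]
  intro z hz hz0
  have hGz := hGne z hz
  have hc' : (1 + c : ℂ) ≠ 0 := by rwa [add_comm]
  have hq : z * deriv (bernardi c f) z / bernardi c f z = g z / G z - c := by
    have h1 : HasDerivAt (bernardi c f) ((1 + c) * (1 * G z + z * G' z)) z := by
      rw [funext (bernardi_eq c hf0)]
      exact ((hasDerivAt_id z).mul (hGD z hz)).const_mul _
    rw [h1.deriv, bernardi_eq c hf0, ← hgdef, ← hGdef]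
    field_simp
    linear_combination hode z hz
  have hs1 := hsector _ (Or.inl rfl) z hz
  have hs2 := hsector _ (Or.inr rfl) z hz
  have hqne : g z / G z - c ≠ 0 := by
    intro h
    simp [h] at hs1
  rw [hq]
  refine ⟨?_, hqne, (abs_arg_lt_iff hβ0 hβ1 hqne).mpr ⟨hs1, hs2⟩⟩
  rw [bernardi_eq c hf0]
  exact mul_ne_zero hc' (mul_ne_zero hz0 hGz)
end
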